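/- arXiv:1409.3829 — 7 statements merged into one kernel-verified Lean document; each statement's English description precedes it below -/
import Mathlib

section
/- For every τ in the complex upper half-plane ℍ, the discriminant function satisfies (1/2)·( Δ(τ)² / (Δ(2τ)·Δ(τ/2)) − Δ(τ/2)/Δ(τ) ) = 24 + 2^11 · Δ(2τ)/Δ(τ). -/
open Complex

/-- The discriminant function `Δ(τ) = q ∏_{n≥1} (1 - qⁿ)²⁴` with `q = exp(2πiτ)`. -/
noncomputable def Δ (τ : ℂ) : ℂ :=
  Complex.exp (2 * Real.pi * Complex.I * τ) *
    ∏' n : ℕ, (1 - Complex.exp (2 * Real.pi * Complex.I * τ) ^ (n + 1)) ^ 24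

/-- Euler product. -/
noncomputable def eulerP (x : ℂ) : ℂ := ∏' n : ℕ, (1 - x ^ (n + 1))

lemma mult_aux {x : ℂ} (hx : ‖x‖ < 1) (a b : ℕ) (ha : 0 < a) :
    Multipliable fun n : ℕ ↦ 1 - x ^ (a * n + b) := by
  have : Summable fun n : ℕ ↦ ‖x ^ (a * n + b)‖ := by
    simp only [pow_add, pow_mul, norm_mul, norm_pow]
    exact (summable_geometric_of_lt_one (by positivity)
      (pow_lt_one₀ (norm_nonneg _) hx ha.ne')).mul_right _
  simpa [sub_eq_add_neg] using multipliable_one_add_of_summable (f := fun n : ℕ ↦ -x ^ (a * n + b))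
    (by simpa using this)

noncomputable def oddP (x : ℂ) : ℂ := ∏' n : ℕ, (1 - x ^ (2 * n + 1))

lemma eulerP_split {x : ℂ} (hx : ‖x‖ < 1) : eulerP x = oddP x * eulerP (x ^ 2) := by
  have h := tprod_even_mul_odd (f := fun n : ℕ ↦ 1 - x ^ (n + 1))
    (mult_aux hx 2 1 two_pos) (by simpa [add_assoc] using mult_aux hx 2 2 two_pos)
  rw [eulerP, ← h, oddP, eulerP]
  congr 1
  refine tprod_congr fun n ↦ ?_
  rw [← pow_mul]; ring_nf

lemma oddP_mul {x : ℂ} (hx : ‖x‖ < 1) : oddP x * oddP (-x) = oddP (x ^ 2) := by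
  unfold oddP
  rw [← Multipliable.tprod_mul (mult_aux hx 2 1 two_pos)
    (mult_aux (by simpa using hx) 2 1 two_pos)]
  refine tprod_congr fun n ↦ ?_
  rw [Odd.neg_pow ⟨n, rfl⟩, ← pow_mul]; ring

lemma eulerP_identity {x : ℂ} (hx : ‖x‖ < 1) :
    eulerP x * eulerP (-x) * eulerP (x ^ 4) = eulerP (x ^ 2) ^ 3 := by
  have hx2 : ‖x ^ 2‖ < 1 := by
    rw [norm_pow]; exact pow_lt_one₀ (norm_nonneg _) hx two_ne_zero
  have h1 := eulerP_split hx
  have h2 := eulerP_split (x := -x) (by simpa using hx)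
  have h3 := eulerP_split hx2
  have h4 := oddP_mul hx
  rw [neg_sq] at h2
  rw [← pow_mul] at h3
  norm_num at h3
  linear_combination (eulerP (-x) * eulerP (x ^ 4)) * h1 +
    oddP x * eulerP (x ^ 2) * eulerP (x ^ 4) * h2 + eulerP (x ^ 2) ^ 2 * eulerP (x ^ 4) * h4
    - eulerP (x ^ 2) ^ 2 * h3

lemma eulerP_ne_zero {x : ℂ} (hx : ‖x‖ < 1) : eulerP x ≠ 0 := by
  unfold eulerP
  simp_rw [sub_eq_add_neg]
  refine tprod_one_add_ne_zero_of_summable (f := fun n : ℕ ↦ -x ^ (n + 1)) ?_ ?_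
  · intro i h
    have : x ^ (i + 1) = 1 := by linear_combination -h
    have h2 : ‖x ^ (i + 1)‖ < 1 := by
      rw [norm_pow]; exact pow_lt_one₀ (norm_nonneg _) hx (by simp)
    rw [this] at h2; simp at h2
  · simpa using (summable_nat_add_iff 1).mpr (summable_geometric_of_lt_one (norm_nonneg _) hx)

lemma eulerP_zero : eulerP 0 = 1 := by simp [eulerP]

lemma eulerP_diff {x : ℂ} (hx : ‖x‖ < 1) : DifferentiableAt ℂ eulerP x :=
  ModularForm.differentiableOn_tprod_one_sub_pow.differentiableAt
    (Metric.isOpen_ball.mem_nhds (by simpa using hx))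

lemma logDeriv_aux (n : ℕ) : logDeriv (fun x : ℂ ↦ 1 - x ^ (n + 1)) 0 = if n = 0 then -1 else 0 := by
  rw [logDeriv_apply]
  rcases n with _ | n <;> simp

lemma eulerP_deriv : HasDerivAt eulerP (-1) 0 := by
  have h := logDeriv_tprod_eq_tsum (f := fun (n : ℕ) (x : ℂ) ↦ 1 - x ^ (n + 1))
    (Metric.isOpen_ball (x := (0:ℂ)) (ε := 1)) (x := 0) (by simp)
    (by simp) (by fun_prop) (by
      simp only [logDeriv_aux]
      exact (hasSum_ite_eq 0 (-1 : ℂ)).summable)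
    ModularForm.multipliableLocallyUniformlyOn_one_sub_pow
    (eulerP_ne_zero (x := 0) (by simp))
  simp only [logDeriv_aux, tsum_ite_eq] at h
  rw [logDeriv_apply] at h
  change deriv eulerP 0 / eulerP 0 = -1 at h
  rw [eulerP_zero, div_one] at h
  rw [← h]
  exact (eulerP_diff (by simp)).hasDerivAt

lemma norm_e_lt {τ : ℂ} (hτ : 0 < τ.im) : ‖Complex.exp (2 * Real.pi * Complex.I * τ)‖ < 1 :=
  UpperHalfPlane.norm_exp_two_pi_I_lt_one ⟨τ, hτ⟩

lemma delta_eq {τ : ℂ} (hτ : 0 < τ.im) :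
    Δ τ = Complex.exp (2 * Real.pi * Complex.I * τ) *
      eulerP (Complex.exp (2 * Real.pi * Complex.I * τ)) ^ 24 := by
  rw [Δ, eulerP, (ModularForm.multipliable_one_sub_pow (norm_e_lt hτ)).tprod_pow]

lemma delta_ne_zero {τ : ℂ} (hτ : 0 < τ.im) : Δ τ ≠ 0 := by
  rw [delta_eq hτ]
  exact mul_ne_zero (Complex.exp_ne_zero _) (pow_ne_zero _ (eulerP_ne_zero (norm_e_lt hτ)))

lemma delta_disc (z : UpperHalfPlane) : Δ z = ModularForm.discriminant z := by
  rw [ModularForm.discriminant_eq_q_prod]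
  simp only [ModularForm.eta_q_eq_pow]
  simp [Δ, Function.Periodic.qParam]

lemma delta_diff {τ : ℂ} (hτ : 0 < τ.im) : DifferentiableAt ℂ Δ τ := by
  have h : DifferentiableAt ℂ (fun τ : ℂ ↦ Complex.exp (2 * Real.pi * Complex.I * τ) *
      eulerP (Complex.exp (2 * Real.pi * Complex.I * τ)) ^ 24) τ := by
    have h1 : DifferentiableAt ℂ (fun τ : ℂ ↦ Complex.exp (2 * Real.pi * Complex.I * τ)) τ := by
      fun_prop
    exact h1.mul (((eulerP_diff (norm_e_lt hτ)).comp τ h1).pow 24)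
  refine h.congr_of_eventuallyEq ?_
  filter_upwards [UpperHalfPlane.isOpen_upperHalfPlaneSet.mem_nhds hτ] with z hz
  exact delta_eq hz

lemma delta_T (τ : ℂ) : Δ (τ + 1) = Δ τ := by
  have : Complex.exp (2 * Real.pi * Complex.I * (τ + 1)) = Complex.exp (2 * Real.pi * Complex.I * τ) := by
    rw [mul_add, mul_one]; exact Complex.exp_periodic _
  simp only [Δ, this]

lemma delta_S {τ : ℂ} (hτ : 0 < τ.im) : Δ (-1 / τ) = τ ^ 12 * Δ τ := by
  have h := congrFun ModularForm.discriminant_S_invariant ⟨τ, hτ⟩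
  rw [SlashInvariantForm.slash_S_apply, ← delta_disc, ← delta_disc] at h
  have hne : τ ≠ 0 := by rintro rfl; simp at hτ
  simp at h
  rw [neg_div, one_div, ← h]
  field_simp

lemma delta_triple {τ : ℂ} (hτ : 0 < τ.im) :
    Δ τ ^ 3 = - (Δ (2 * τ) * Δ (τ / 2) * Δ ((τ + 1) / 2)) := by
  have h2 : 0 < (τ / 2).im := by simpa using hτ
  have h3 : 0 < ((τ + 1) / 2).im := by simpa using hτ
  have h4 : 0 < (2 * τ).im := by simpa using hτ
  rw [delta_eq hτ, delta_eq h2, delta_eq h3, delta_eq h4]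
  have hx := norm_e_lt h2
  set x := Complex.exp (2 * Real.pi * Complex.I * (τ / 2)) with hxdef
  have e1 : Complex.exp (2 * Real.pi * Complex.I * τ) = x ^ 2 := by
    rw [hxdef, ← Complex.exp_nat_mul]; congr 1; push_cast; ring
  have e2 : Complex.exp (2 * Real.pi * Complex.I * (2 * τ)) = x ^ 4 := by
    rw [hxdef, ← Complex.exp_nat_mul]; congr 1; push_cast; ring
  have e3 : Complex.exp (2 * Real.pi * Complex.I * ((τ + 1) / 2)) = -x := by
    rw [show 2 * Real.pi * Complex.I * ((τ + 1) / 2) =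
      2 * Real.pi * Complex.I * (τ / 2) + Real.pi * Complex.I by ring, Complex.exp_add,
      Complex.exp_pi_mul_I]; ring
  rw [e1, e2, e3]
  have := congrArg (fun y ↦ x ^ 6 * y ^ 24) (eulerP_identity hx)
  linear_combination -this

/-- The function to be shown constant. -/
noncomputable def gfun (τ : ℂ) : ℂ :=
  Δ τ ^ 2 / (Δ (2 * τ) * Δ (τ / 2)) - Δ (τ / 2) / Δ τ - 2 ^ 12 * (Δ (2 * τ) / Δ τ)

lemma gfun_eq {τ : ℂ} (hτ : 0 < τ.im) :
    gfun τ = -Δ ((τ + 1) / 2) / Δ τ - Δ (τ / 2) / Δ τ - 2 ^ 12 * (Δ (2 * τ) / Δ τ) := by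
  have h2 : Δ (τ / 2) ≠ 0 := delta_ne_zero (by simpa using hτ)
  have h4 : Δ (2 * τ) ≠ 0 := delta_ne_zero (by simpa using hτ)
  have h1 := delta_ne_zero hτ
  have h := delta_triple hτ
  rw [gfun]
  congr 2
  field_simp
  linear_combination h

lemma gfun_T {τ : ℂ} (hτ : 0 < τ.im) : gfun (τ + 1) = gfun τ := by
  rw [gfun_eq (by simpa using hτ), gfun_eq hτ, delta_T,
    show (τ + 1 + 1) / 2 = τ / 2 + 1 by ring, delta_T,
    show 2 * (τ + 1) = 2 * τ + 1 + 1 by ring, delta_T, delta_T]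
  ring

lemma gfun_S {τ : ℂ} (hτ : 0 < τ.im) : gfun (-1 / τ) = gfun τ := by
  have hne : τ ≠ 0 := by rintro rfl; simp at hτ
  have p2 : 0 < (τ / 2).im := by simpa using hτ
  have p4 : 0 < (2 * τ).im := by simpa using hτ
  have h2 : Δ (τ / 2) ≠ 0 := delta_ne_zero p2
  have h4 : Δ (2 * τ) ≠ 0 := delta_ne_zero p4
  have h1 := delta_ne_zero hτ
  rw [gfun, gfun, delta_S hτ, show 2 * (-1 / τ) = -1 / (τ / 2) by field_simp, delta_S p2,
    show -1 / τ / 2 = -1 / (2 * τ) by field_simp, delta_S p4]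
  generalize Δ (2 * τ) = A at *
  generalize Δ (τ / 2) = B at *
  field_simp
  ring

lemma gfun_diff {τ : ℂ} (hτ : 0 < τ.im) : DifferentiableAt ℂ gfun τ := by
  have p2 : 0 < (τ / 2).im := by simpa using hτ
  have p4 : 0 < (2 * τ).im := by simpa using hτ
  have d1 := delta_diff hτ
  have d2 : DifferentiableAt ℂ (fun τ ↦ Δ (τ / 2)) τ :=
    (delta_diff p2).comp τ (f := fun τ ↦ τ / 2) (by fun_prop)
  have d4 : DifferentiableAt ℂ (fun τ ↦ Δ (2 * τ)) τ :=
    (delta_diff p4).comp τ (f := fun τ ↦ 2 * τ) (by fun_prop)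
  exact (((d1.pow 2).div (d4.mul d2) (mul_ne_zero (delta_ne_zero p4) (delta_ne_zero p2))).sub
    (d2.div d1 (delta_ne_zero hτ))).sub ((d4.div d1 (delta_ne_zero hτ)).const_mul _)

lemma gfun_eq_x {τ : ℂ} (hτ : 0 < τ.im) (x : ℂ)
    (hxdef : x = Complex.exp (2 * Real.pi * Complex.I * (τ / 2))) :
    gfun τ = -(x⁻¹ * (eulerP x ^ 24 - eulerP (-x) ^ 24)) / eulerP (x ^ 2) ^ 24
      - 2 ^ 12 * (x ^ 2 * eulerP (x ^ 4) ^ 24 / eulerP (x ^ 2) ^ 24) := by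
  have h2 : 0 < (τ / 2).im := by simpa using hτ
  have h3 : 0 < ((τ + 1) / 2).im := by simpa using hτ
  have h4 : 0 < (2 * τ).im := by simpa using hτ
  have hP := eulerP_ne_zero (norm_e_lt hτ)
  rw [gfun_eq hτ, delta_eq hτ, delta_eq h2, delta_eq h3, delta_eq h4]
  have hx0 : x ≠ 0 := hxdef ▸ Complex.exp_ne_zero _
  have e1 : Complex.exp (2 * Real.pi * Complex.I * τ) = x ^ 2 := by
    rw [hxdef, ← Complex.exp_nat_mul]; congr 1; push_cast; ring
  have e2 : Complex.exp (2 * Real.pi * Complex.I * (2 * τ)) = x ^ 4 := by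
    rw [hxdef, ← Complex.exp_nat_mul]; congr 1; push_cast; ring
  have e3 : Complex.exp (2 * Real.pi * Complex.I * ((τ + 1) / 2)) = -x := by
    rw [show 2 * Real.pi * Complex.I * ((τ + 1) / 2) =
      2 * Real.pi * Complex.I * (τ / 2) + Real.pi * Complex.I by ring, Complex.exp_add,
      Complex.exp_pi_mul_I, hxdef]; ring
  rw [e1, e2, e3, ← hxdef]
  rw [e1] at hP
  field_simp
  ring

open Filter Topology in
lemma x_tendsto : Tendsto (fun x : ℂ ↦ -(x⁻¹ * (eulerP x ^ 24 - eulerP (-x) ^ 24)) /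
    eulerP (x ^ 2) ^ 24 - 2 ^ 12 * (x ^ 2 * eulerP (x ^ 4) ^ 24 / eulerP (x ^ 2) ^ 24))
    (𝓝[≠] 0) (𝓝 48) := by
  have hd : HasDerivAt (fun x ↦ eulerP x ^ 24 - eulerP (-x) ^ 24) (-48) 0 := by
    have hn : HasDerivAt (fun x ↦ eulerP (-x)) (1) 0 := by
      have := HasDerivAt.comp (0:ℂ) (h₂ := eulerP) (h := fun x ↦ -x) (h₂' := -1)
        (by simpa using eulerP_deriv) (hasDerivAt_neg (0:ℂ))
      simpa [Function.comp_def] using this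
    have := (eulerP_deriv.pow 24).sub (hn.pow 24)
    convert! this using 1
    simp [eulerP_zero]; norm_num
  have hs := hd.tendsto_slope_zero
  simp only [zero_add, eulerP_zero, neg_zero, sub_self, sub_zero, smul_eq_mul] at hs
  have hc : ContinuousAt eulerP 0 := eulerP_deriv.continuousAt
  have ck (k : ℕ) (hk : k ≠ 0) : Tendsto (fun x : ℂ ↦ eulerP (x ^ k) ^ 24) (𝓝[≠] 0) (𝓝 1) := by
    have : ContinuousAt (fun x : ℂ ↦ eulerP (x ^ k) ^ 24) 0 := by
      refine ContinuousAt.pow ?_ 24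
      exact ContinuousAt.comp (f := fun x : ℂ ↦ x ^ k) (g := eulerP) (by simpa [hk] using hc)
        (by fun_prop)
    have h := this.tendsto.mono_left (nhdsWithin_le_nhds (s := {0}ᶜ))
    simpa [hk, eulerP_zero] using h
  have hx2 : Tendsto (fun x : ℂ ↦ x ^ 2) (𝓝[≠] 0) (𝓝 0) := by
    have : ContinuousAt (fun x : ℂ ↦ x ^ 2) 0 := by fun_prop
    simpa using this.tendsto.mono_left (nhdsWithin_le_nhds (s := {0}ᶜ))
  have := (hs.neg.div (ck 2 two_ne_zero) one_ne_zero).sub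
    (((hx2.mul (ck 4 four_ne_zero)).div (ck 2 two_ne_zero) one_ne_zero).const_mul (2 ^ 12))
  simpa using this

open Filter Topology UpperHalfPlane in
lemma gfun_tendsto : Tendsto (fun z : ℍ ↦ gfun z) atImInfty (𝓝 48) := by
  have hx : Tendsto (fun z : ℍ ↦ Complex.exp (2 * Real.pi * Complex.I * ((z : ℂ) / 2)))
      atImInfty (𝓝[≠] 0) := by
    refine tendsto_nhdsWithin_iff.mpr ⟨?_, .of_forall fun z ↦ Complex.exp_ne_zero _⟩
    have := UpperHalfPlane.qParam_tendsto_atImInfty (h := 2) two_pos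
    refine this.congr fun z ↦ ?_
    simp [Function.Periodic.qParam]
    ring_nf
  exact (x_tendsto.comp hx).congr fun z ↦ (gfun_eq_x z.2 _ rfl).symm

open UpperHalfPlane MatrixGroups in
lemma gfun_slash (γ : SL(2, ℤ)) : SlashAction.map (0 : ℤ) γ (fun z : ℍ ↦ gfun z) =
    (fun z : ℍ ↦ gfun z) := by
  refine SlashInvariantForm.slash_action_generators_SL2Z ?_ ?_ γ
  · ext z
    rw [SlashInvariantForm.slash_S_apply]
    simpa [neg_div] using gfun_S z.2
  · ext z
    rw [ModularForm.SL_slash_apply, UpperHalfPlane.modular_T_smul]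
    simpa [add_comm] using gfun_T z.2

open UpperHalfPlane MatrixGroups in
/-- `gfun` as a modular form of level one and weight zero. -/
noncomputable def gform : ModularForm 𝒮ℒ 0 where
  toFun := fun z ↦ gfun z
  slash_action_eq' A hA := by
    obtain ⟨A, rfl⟩ := hA
    exact gfun_slash A
  holo' := by
    rw [UpperHalfPlane.mdifferentiable_iff]
    refine .congr (fun z hz ↦ (gfun_diff hz).differentiableWithinAt) fun z hz ↦ ?_
    simp [ofComplex_apply_of_im_pos hz]
  bdd_at_cusps' hc := by
    rw [Subgroup.IsArithmetic.isCusp_iff_isCusp_SL2Z] at hc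
    rw [OnePoint.isBoundedAt_iff_forall_SL2Z hc]
    intro γ _
    rw [gfun_slash]
    exact gfun_tendsto.isBigO_one ℝ

lemma gfun_const {τ : ℂ} (hτ : 0 < τ.im) : gfun τ = 48 := by
  obtain ⟨c, hc⟩ := ModularFormClass.levelOne_weight_zero_const gform
  have h (z : UpperHalfPlane) : gfun z = c := congrFun hc z
  have ht := gfun_tendsto
  simp only [h] at ht
  rw [h ⟨τ, hτ⟩]
  exact tendsto_nhds_unique tendsto_const_nhds ht

/-- For every `τ` in the upper half-plane,
`(1/2)·(Δ(τ)²/(Δ(2τ)Δ(τ/2)) − Δ(τ/2)/Δ(τ)) = 24 + 2¹¹·Δ(2τ)/Δ(τ)`. -/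
theorem half_mul_delta_ratio_identity (τ : ℂ) (hτ : 0 < τ.im) :
    (1 / 2 : ℂ) * (Δ τ ^ 2 / (Δ (2 * τ) * Δ (τ / 2)) - Δ (τ / 2) / Δ τ)
      = 24 + 2 ^ 11 * (Δ (2 * τ) / Δ τ) := by
  have h := gfun_const hτ
  rw [gfun] at h
  linear_combination (1 / 2 : ℂ) * h
end

section
/- For every τ in the complex upper half-plane ℍ, Δ(τ/2)·Δ((τ+1)/2)·Δ(2τ) = −Δ(τ)³. (Equivalently, the function f(τ) = Δ(2τ)/Δ(τ) satisfies f((τ+1)/2) = −f(τ)/f(τ/2).) -/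
open Complex

/-- Convergence of the odd part of the product. -/
lemma multipliable_odd_part {x : ℂ} (hx : ‖x‖ < 1) :
    Multipliable fun n : ℕ ↦ 1 - x ^ (2 * n + 1) := by
  have h : Summable fun n : ℕ ↦ ‖x‖ ^ n := summable_geometric_of_lt_one (norm_nonneg _) hx
  have h2 : Summable fun n : ℕ ↦ ‖x‖ ^ (2 * n + 1) :=
    h.comp_injective (i := fun n : ℕ ↦ 2 * n + 1) (fun a b hab ↦ by simp at hab; exact hab)
  have := multipliable_one_add_of_summable (f := fun n : ℕ ↦ -x ^ (2 * n + 1)) (by simpa using h2)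
  simpa [sub_eq_add_neg] using this

/-- Splitting the product into odd and even exponents. -/
lemma euler_split {x : ℂ} (hx : ‖x‖ < 1) :
    ∏' n : ℕ, (1 - x ^ (n + 1)) =
      (∏' n : ℕ, (1 - x ^ (2 * n + 1))) * ∏' n : ℕ, (1 - (x ^ 2) ^ (n + 1)) := by
  have hx2 : ‖x ^ 2‖ < 1 := by
    rw [norm_pow]; exact pow_lt_one₀ (norm_nonneg _) hx (by norm_num)
  have e : ∀ n : ℕ, 1 - (x ^ 2) ^ (n + 1) = 1 - x ^ (2 * n + 1 + 1) := fun n ↦ by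
    rw [← pow_mul]; ring_nf
  have h := ModularForm.multipliable_one_sub_pow hx2
  simp only [e] at h ⊢
  exact (tprod_even_mul_odd (f := fun n : ℕ ↦ 1 - x ^ (n + 1)) (multipliable_odd_part hx) h).symm

lemma euler_identity {p : ℂ} (hp : ‖p‖ < 1) :
    (∏' n : ℕ, (1 - p ^ (n + 1))) * (∏' n : ℕ, (1 - (-p) ^ (n + 1))) *
      (∏' n : ℕ, (1 - (p ^ 4) ^ (n + 1))) = (∏' n : ℕ, (1 - (p ^ 2) ^ (n + 1))) ^ 3 := by
  have hp2 : ‖p ^ 2‖ < 1 := by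
    rw [norm_pow]; exact pow_lt_one₀ (norm_nonneg _) hp (by norm_num)
  have hn : ‖-p‖ < 1 := by simpa using hp
  have hodd : (∏' n : ℕ, (1 - p ^ (2 * n + 1))) * (∏' n : ℕ, (1 - (-p) ^ (2 * n + 1))) =
      ∏' n : ℕ, (1 - (p ^ 2) ^ (2 * n + 1)) := by
    rw [← (multipliable_odd_part hp).tprod_mul (multipliable_odd_part hn)]
    refine tprod_congr fun n ↦ ?_
    rw [Odd.neg_pow ⟨n, rfl⟩]; ring
  have h3 := euler_split hp2
  rw [← hodd, ← pow_mul] at h3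
  have h1 := euler_split hp
  have h2 := euler_split hn
  rw [neg_sq] at h2
  norm_num at h3
  rw [h1, h2]
  linear_combination (-(∏' n : ℕ, (1 - (p ^ 2) ^ (n + 1))) ^ 2) * h3

/-- For every `τ` in the upper half-plane, `Δ(τ/2)·Δ((τ+1)/2)·Δ(2τ) = −Δ(τ)³`. -/
theorem delta_half_mul_delta_half_shift_mul_delta_two (τ : ℂ) (hτ : 0 < τ.im) :
    Δ (τ / 2) * Δ ((τ + 1) / 2) * Δ (2 * τ) = -(Δ τ ^ 3) := by
  obtain ⟨p, hpdef⟩ : ∃ p, p = Complex.exp (Real.pi * Complex.I * τ) := ⟨_, rfl⟩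
  have hp : ‖p‖ < 1 := by
    rw [hpdef, Complex.norm_exp, Real.exp_lt_one_iff]
    simp
    positivity
  have e1 : Complex.exp (2 * Real.pi * Complex.I * (τ / 2)) = p := by
    rw [hpdef]; ring_nf
  have e2 : Complex.exp (2 * Real.pi * Complex.I * ((τ + 1) / 2)) = -p := by
    rw [show 2 * Real.pi * Complex.I * ((τ + 1) / 2)
      = Real.pi * Complex.I * τ + Real.pi * Complex.I by ring, Complex.exp_add,
      Complex.exp_pi_mul_I, hpdef]; ring
  have e3 : Complex.exp (2 * Real.pi * Complex.I * (2 * τ)) = p ^ 4 := by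
    rw [hpdef, ← Complex.exp_nat_mul]; push_cast; ring_nf
  have e4 : Complex.exp (2 * Real.pi * Complex.I * τ) = p ^ 2 := by
    rw [hpdef, ← Complex.exp_nat_mul]; push_cast; ring_nf
  have hn : ‖-p‖ < 1 := by simpa using hp
  have hk : ∀ k : ℕ, k ≠ 0 → ‖p ^ k‖ < 1 := fun k hk ↦ by
    rw [norm_pow]; exact pow_lt_one₀ (norm_nonneg _) hp hk
  unfold Δ
  rw [e1, e2, e3, e4, (ModularForm.multipliable_one_sub_pow hp).tprod_pow,
    (ModularForm.multipliable_one_sub_pow hn).tprod_pow,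
    (ModularForm.multipliable_one_sub_pow (hk 4 (by norm_num))).tprod_pow,
    (ModularForm.multipliable_one_sub_pow (hk 2 (by norm_num))).tprod_pow]
  have h := congrArg (fun z ↦ -p ^ 6 * z ^ 24) (euler_identity hp)
  simp only [mul_pow] at h
  linear_combination h
end

section
/- For every τ in the complex upper half-plane ℍ, the function f(τ) = Δ(2τ)/Δ(τ) satisfies the Hecke-operator identity (1/2)·( f(τ/2) + f((τ+1)/2) ) = 2^11 · f(τ)² + 24 · f(τ). -/
open Complex

/-- The function `f(τ) = Δ(2τ)/Δ(τ)`. -/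
noncomputable def f (τ : ℂ) : ℂ := Δ (2 * τ) / Δ τ

namespace HeckeAux

open Filter Topology

lemma hs_congr {ι : Type} {g h : ι → ℂ} {a b : ℂ} (hh : HasSum h b) (hg : ∀ i, g i = h i)
    (hab : a = b) : HasSum g a := by
  rw [funext hg, hab]; exact hh

/-- Euler product. -/
noncomputable def E (x : ℂ) : ℂ := ∏' n : ℕ, (1 - x ^ (n + 1))

/-- Odd product. -/
noncomputable def O (z x : ℂ) : ℂ := ∏' n : ℕ, (1 + z * x ^ (2 * n + 1))

/-- Finite Euler product. -/
noncomputable def P (Q : ℂ) (n : ℕ) : ℂ := ∏ k ∈ Finset.range n, (1 - Q ^ (k + 1))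

/-- Inverse of the finite Euler product, extended by zero. -/
noncomputable def ip (Q : ℂ) (n : ℤ) : ℂ := if 0 ≤ n then (P Q n.toNat)⁻¹ else 0

/-- Theta series. -/
noncomputable def T (z x : ℂ) : ℂ := ∑' j : ℤ, z ^ j * x ^ (j ^ 2)

lemma one_sub_ne {x : ℂ} (hx : ‖x‖ < 1) (n : ℕ) : 1 - x ^ (n + 1) ≠ 0 := by
  intro h
  have h1 : x ^ (n + 1) = 1 := (sub_eq_zero.mp h).symm
  have h2 : ‖x‖ ^ (n + 1) = 1 := by rw [← norm_pow, h1, norm_one]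
  have h3 := pow_lt_one₀ (norm_nonneg x) hx (Nat.succ_ne_zero n)
  rw [Nat.succ_eq_add_one] at h3
  linarith

lemma summable_pow {x : ℂ} (hx : ‖x‖ < 1) : Summable fun n : ℕ => ‖-x ^ (n + 1)‖ := by
  simp only [norm_neg, norm_pow]
  exact (summable_nat_add_iff 1).mpr (summable_geometric_of_lt_one (norm_nonneg x) hx)

lemma summable_odd (z : ℂ) {x : ℂ} (hx : ‖x‖ < 1) :
    Summable fun n : ℕ => ‖z * x ^ (2 * n + 1)‖ := by
  simp only [norm_mul, norm_pow]
  apply Summable.mul_left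
  have h := summable_geometric_of_lt_one (norm_nonneg x) hx
  exact h.comp_injective (i := fun n : ℕ => 2 * n + 1) (fun a b h => by simpa using h)

lemma mult_E {x : ℂ} (hx : ‖x‖ < 1) : Multipliable fun n : ℕ => 1 - x ^ (n + 1) :=
  ModularForm.multipliable_one_sub_pow hx

lemma mult_O (z : ℂ) {x : ℂ} (hx : ‖x‖ < 1) : Multipliable fun n : ℕ => 1 + z * x ^ (2 * n + 1) :=
  multipliable_one_add_of_summable (summable_odd z hx)

lemma E_ne {x : ℂ} (hx : ‖x‖ < 1) : E x ≠ 0 := by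
  have := tprod_one_add_ne_zero_of_summable (f := fun n : ℕ => -x ^ (n + 1))
    (fun n => by simpa [← sub_eq_add_neg] using one_sub_ne hx n) (summable_pow hx)
  simpa [E, ← sub_eq_add_neg] using this

lemma sq_lt {x : ℂ} (hx : ‖x‖ < 1) : ‖x ^ 2‖ < 1 := by
  rw [norm_pow]; exact pow_lt_one₀ (norm_nonneg x) hx two_ne_zero

lemma E_split {x : ℂ} (hx : ‖x‖ < 1) : E x = E (x ^ 2) * O (-1) x := by
  have h2 := mult_E (sq_lt hx)
  have h1 := mult_O (-1) hx
  have e1 : (fun n : ℕ => 1 + (-1) * x ^ (2 * n + 1)) = fun n : ℕ => 1 - x ^ (2 * n + 1) := by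
    funext n; ring
  have e2 : (fun n : ℕ => 1 - (x ^ 2) ^ (n + 1)) = fun n : ℕ => 1 - x ^ (2 * n + 1 + 1) := by
    funext n; rw [← pow_mul]; ring_nf
  unfold E O
  rw [e1] at h1 ⊢
  rw [e2] at h2 ⊢
  rw [mul_comm, tprod_even_mul_odd (f := fun n : ℕ => 1 - x ^ (n + 1)) h1 h2]

lemma O_neg (x : ℂ) (z : ℂ) : O z (-x) = O (-z) x := by
  unfold O
  congr 1; funext n
  rw [Odd.neg_pow ⟨n, rfl⟩]; ring

/-- First product identity. -/
lemma H1 {x : ℂ} (hx : ‖x‖ < 1) : E (x ^ 4) * E x * E (-x) = E (x ^ 2) ^ 3 := by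
  have h1 := E_split hx
  have h2 := E_split (x := -x) (by simpa using hx)
  rw [neg_sq, O_neg, neg_neg] at h2
  have h3 := E_split (sq_lt hx)
  have h4 : O (-1) x * O 1 x = O (-1) (x ^ 2) := by
    unfold O
    rw [← (mult_O _ hx).tprod_mul (mult_O _ hx)]
    congr 1; funext n
    rw [← pow_mul]; ring
  rw [← pow_mul] at h3
  rw [h1, h2]
  norm_num at h3
  have : E (x ^ 4) * (E (x ^ 2) * O (-1) x) * (E (x ^ 2) * O 1 x)
    = E (x ^ 2) ^ 2 * (E (x ^ 4) * (O (-1) x * O 1 x)) := by ring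
  rw [this, h4, ← h3]; ring

lemma P_ne {Q : ℂ} (hQ : ‖Q‖ < 1) (n : ℕ) : P Q n ≠ 0 :=
  Finset.prod_ne_zero_iff.mpr fun k _ => one_sub_ne hQ k

lemma P_tendsto {Q : ℂ} (hQ : ‖Q‖ < 1) : Tendsto (P Q) atTop (𝓝 (E Q)) :=
  (mult_E hQ).hasProd.tendsto_prod_nat

lemma ip_rec {Q : ℂ} (hQ : ‖Q‖ < 1) (n : ℤ) : ip Q (n - 1) = (1 - Q ^ n) * ip Q n := by
  unfold ip
  rcases lt_trichotomy n 0 with h | h | h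
  · rw [if_neg (by omega), if_neg (by omega), mul_zero]
  · subst h; simp
  · obtain ⟨m, rfl⟩ : ∃ m : ℕ, n = m + 1 := ⟨(n - 1).toNat, by omega⟩
    rw [if_pos (by omega), if_pos (by omega)]
    have e1 : ((m : ℤ) + 1 - 1).toNat = m := by omega
    have e2 : ((m : ℤ) + 1).toNat = m + 1 := by omega
    rw [e1, e2]
    have h3 : P Q (m + 1) = P Q m * (1 - Q ^ (m + 1)) := Finset.prod_range_succ _ _
    have h4 := one_sub_ne hQ m
    have h5 := P_ne hQ m
    have e3 : Q ^ ((m : ℤ) + 1) = Q ^ (m + 1) := by exact_mod_cast zpow_natCast Q (m + 1)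
    rw [h3, e3]
    field_simp

/-- Finite Jacobi triple product. -/
lemma finite_triple {x z : ℂ} (hx : ‖x‖ < 1) (hx0 : x ≠ 0) (hz : z ≠ 0) (N : ℕ) :
    HasSum (fun j : ℤ => P (x ^ 2) (2 * N) * ip (x ^ 2) (N - j) * ip (x ^ 2) (N + j)
        * (z ^ j * x ^ (j ^ 2)))
      (∏ k ∈ Finset.range N, ((1 + z * x ^ (2 * k + 1)) * (1 + z⁻¹ * x ^ (2 * k + 1)))) := by
  have hQ := sq_lt hx
  have hQ0 : x ^ 2 ≠ 0 := pow_ne_zero _ hx0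
  induction N with
  | zero =>
    have := hasSum_single (f := fun j : ℤ => P (x ^ 2) (2 * 0) * ip (x ^ 2) ((0 : ℕ) - j)
      * ip (x ^ 2) ((0 : ℕ) + j) * (z ^ j * x ^ (j ^ 2))) 0 (by
        intro j hj
        rcases lt_or_gt_of_ne hj with h | h
        · simp [ip, h]
        · simp [ip, h])
    simpa [ip, P] using this
  | succ N ih =>
    rw [Finset.prod_range_succ]
    set A := ∏ k ∈ Finset.range N, ((1 + z * x ^ (2 * k + 1)) * (1 + z⁻¹ * x ^ (2 * k + 1)))
    have s0 := ih.mul_left (1 + x ^ (4 * N + 2))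
    have s1 := ((Equiv.subRight (1 : ℤ)).hasSum_iff.mpr ih).mul_left (x ^ (2 * N + 1) * z)
    have s2 := ((Equiv.addRight (1 : ℤ)).hasSum_iff.mpr ih).mul_left (x ^ (2 * N + 1) * z⁻¹)
    have s := (s0.add s1).add s2
    refine hs_congr s (fun j => ?_) ?_
    · simp only [Function.comp, Equiv.subRight_apply, Equiv.coe_addRight]
      have a1 : ip (x ^ 2) (N - j) = (1 - (x ^ 2) ^ ((N : ℤ) + 1 - j)) * ip (x ^ 2) (N + 1 - j) := by
        rw [← ip_rec hQ]; congr 1; ring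
      have a2 : ip (x ^ 2) (N + j) = (1 - (x ^ 2) ^ ((N : ℤ) + 1 + j)) * ip (x ^ 2) (N + 1 + j) := by
        rw [← ip_rec hQ]; congr 1; ring
      have a3 : ip (x ^ 2) (N - (j - 1)) = ip (x ^ 2) (N + 1 - j) := by congr 1; ring
      have a4 : ip (x ^ 2) (N + (j - 1)) = (1 - (x ^ 2) ^ ((N : ℤ) + j)) * ip (x ^ 2) (N + j) := by
        rw [← ip_rec hQ]; congr 1; ring
      have a5 : ip (x ^ 2) (N - (j + 1)) = (1 - (x ^ 2) ^ ((N : ℤ) - j)) * ip (x ^ 2) (N - j) := by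
        rw [← ip_rec hQ]; congr 1; ring
      have a6 : ip (x ^ 2) (N + (j + 1)) = ip (x ^ 2) (N + 1 + j) := by congr 1; ring
      have a7 : P (x ^ 2) (2 * (N + 1)) = P (x ^ 2) (2 * N) * (1 - (x ^ 2) ^ (2 * N + 1))
          * (1 - (x ^ 2) ^ (2 * N + 2)) := by
        unfold P
        rw [show 2 * (N + 1) = 2 * N + 1 + 1 by ring, Finset.prod_range_succ,
          Finset.prod_range_succ]
      have b1 : z ^ (j - 1) = z ^ j * z⁻¹ := zpow_sub_one₀ hz j
      have b2 : z ^ (j + 1) = z ^ j * z := zpow_add_one₀ hz j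
      have b3 : x ^ ((j - 1) ^ 2) = x ^ (j ^ 2) * ((x ^ 2) ^ j)⁻¹ * x := by
        rw [show (j - 1) ^ 2 = j ^ 2 + (-(2 * j)) + 1 by ring, zpow_add₀ hx0, zpow_add₀ hx0,
          zpow_neg, zpow_mul, zpow_one]
        norm_cast
      have b4 : x ^ ((j + 1) ^ 2) = x ^ (j ^ 2) * ((x ^ 2) ^ j) * x := by
        rw [show (j + 1) ^ 2 = j ^ 2 + ((2 * j)) + 1 by ring, zpow_add₀ hx0, zpow_add₀ hx0,
          zpow_mul, zpow_one]
        norm_cast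
      rw [a3, a4, a5, a6, a1, a2, a7, b1, b2, b3, b4]
      push_cast
      have hs : (x ^ 2) ^ j ≠ 0 := zpow_ne_zero _ hQ0
      simp only [zpow_sub₀ hQ0, zpow_add₀ hQ0, zpow_one, zpow_natCast]
      generalize ip (x ^ 2) ((N : ℤ) + 1 - j) = α
      generalize ip (x ^ 2) ((N : ℤ) + 1 + j) = β
      generalize P (x ^ 2) (2 * N) = p
      generalize x ^ (j ^ 2) = y
      generalize z ^ j = w
      generalize (x ^ 2) ^ j = s at hs
      have c1 : (x ^ 2) ^ (2 * N + 1) = (x ^ N) ^ 4 * x ^ 2 := by ring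
      have c2 : (x ^ 2) ^ (2 * N + 2) = (x ^ N) ^ 4 * x ^ 4 := by ring
      have c3 : (x ^ 2) ^ N = (x ^ N) ^ 2 := by ring
      have c4 : x ^ (4 * N + 2) = (x ^ N) ^ 4 * x ^ 2 := by ring
      have c5 : x ^ (2 * N + 1) = (x ^ N) ^ 2 * x := by ring
      rw [c1, c2, c3, c4, c5]
      generalize x ^ N = m
      field_simp
      ring
    · field_simp
      ring

lemma ip_tendsto {Q : ℂ} (hQ : ‖Q‖ < 1) : Tendsto (ip Q) atTop (𝓝 (E Q)⁻¹) := by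
  have h1 : Tendsto (fun n : ℤ => (P Q n.toNat)⁻¹) atTop (𝓝 (E Q)⁻¹) :=
    ((P_tendsto hQ).comp (tendsto_atTop.mpr fun b => by
      filter_upwards [eventually_ge_atTop (b : ℤ)] with n hn
      omega)).inv₀ (E_ne hQ)
  refine h1.congr' ?_
  filter_upwards [eventually_ge_atTop (0 : ℤ)] with n hn
  simp [ip, hn]

lemma P_bdd {Q : ℂ} (hQ : ‖Q‖ < 1) : ∃ K, ∀ n, ‖P Q n‖ ≤ K := by
  obtain ⟨K, hK⟩ := (P_tendsto hQ).norm.bddAbove_range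
  exact ⟨K, fun n => hK ⟨n, rfl⟩⟩

lemma ip_bdd {Q : ℂ} (hQ : ‖Q‖ < 1) : ∃ K, ∀ n, ‖ip Q n‖ ≤ K := by
  obtain ⟨K, hK⟩ := ((P_tendsto hQ).inv₀ (E_ne hQ)).norm.bddAbove_range
  refine ⟨K, fun n => ?_⟩
  have h0 : ∀ m, ‖(P Q m)⁻¹‖ ≤ K := fun m => hK ⟨m, rfl⟩
  unfold ip
  split_ifs
  · exact h0 _
  · rw [norm_zero]; exact (norm_nonneg _).trans (h0 0)

lemma summable_T {x z : ℂ} (hx : ‖x‖ < 1) (hx0 : x ≠ 0) (hz : z ≠ 0) :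
    Summable fun j : ℤ => ‖z ^ j * x ^ (j ^ 2)‖ := by
  have hpi : (Real.pi : ℂ) ≠ 0 := by exact_mod_cast Real.pi_ne_zero
  have key := (summable_jacobiTheta₂_term_iff (Complex.log z / (2 * Real.pi * I))
    (Complex.log x / (Real.pi * I))).mpr (by
      have : Complex.log x / (Real.pi * I) = (Real.pi⁻¹ : ℝ) * (-I * Complex.log x) := by
        push_cast; field_simp; rw [I_sq]; ring
      rw [this, Complex.im_ofReal_mul]
      have h1 : (-I * Complex.log x).im = - Real.log ‖x‖ := by simp [Complex.log_re]
      rw [h1]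
      have h2 := Real.log_neg (norm_pos_iff.mpr hx0) hx
      have h3 := inv_pos.mpr Real.pi_pos
      nlinarith)
  refine key.norm.congr fun j => ?_
  congr 1
  unfold jacobiTheta₂_term
  have : 2 * (Real.pi : ℂ) * I * j * (Complex.log z / (2 * Real.pi * I))
      + Real.pi * I * (j : ℂ) ^ 2 * (Complex.log x / (Real.pi * I))
      = (j : ℂ) * Complex.log z + ((j ^ 2 : ℤ) : ℂ) * Complex.log x := by
    push_cast; field_simp
  rw [this, Complex.exp_add, Complex.exp_int_mul, Complex.exp_int_mul, Complex.exp_log hz,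
    Complex.exp_log hx0]

/-- Jacobi triple product. -/
lemma triple {x z : ℂ} (hx : ‖x‖ < 1) (hx0 : x ≠ 0) (hz : z ≠ 0) :
    T z x = E (x ^ 2) * (O z x * O z⁻¹ x) := by
  have hQ := sq_lt hx
  have hE := E_ne hQ
  obtain ⟨K, hK⟩ := P_bdd hQ
  obtain ⟨L, hL⟩ := ip_bdd hQ
  have hK0 : 0 ≤ K := (norm_nonneg _).trans (hK 0)
  have hL0 : 0 ≤ L := (norm_nonneg _).trans (hL 0)
  have lim1 := tendsto_tsum_of_dominated_convergence (𝓕 := atTop)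
    (f := fun (N : ℕ) (j : ℤ) => P (x ^ 2) (2 * N) * ip (x ^ 2) (N - j) * ip (x ^ 2) (N + j)
        * (z ^ j * x ^ (j ^ 2)))
    (g := fun j => E (x ^ 2) * (E (x ^ 2))⁻¹ * (E (x ^ 2))⁻¹ * (z ^ j * x ^ (j ^ 2)))
    ((summable_T hx hx0 hz).mul_left (K * L * L))
    (fun j => by
      refine Tendsto.mul_const _ (((?_ : Tendsto _ _ _).mul ?_).mul ?_)
      · exact (P_tendsto hQ).comp (tendsto_id.const_mul_atTop' two_pos)
      · refine (ip_tendsto hQ).comp ?_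
        exact tendsto_atTop_add_const_right _ (-j) tendsto_natCast_atTop_atTop
      · refine (ip_tendsto hQ).comp ?_
        exact tendsto_atTop_add_const_right _ j tendsto_natCast_atTop_atTop)
    (Eventually.of_forall fun N j => by
      rw [norm_mul, norm_mul, norm_mul]
      gcongr
      · exact hK _
      · exact hL _
      · exact hL _)
  have lim2 := ((mult_O z hx).hasProd.mul (mult_O z⁻¹ hx).hasProd).tendsto_prod_nat
  have e : (fun N : ℕ => ∑' j : ℤ, P (x ^ 2) (2 * N) * ip (x ^ 2) (N - j) * ip (x ^ 2) (N + j)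
        * (z ^ j * x ^ (j ^ 2))) = fun N => ∏ k ∈ Finset.range N,
        ((1 + z * x ^ (2 * k + 1)) * (1 + z⁻¹ * x ^ (2 * k + 1))) := by
    funext N; exact (finite_triple hx hx0 hz N).tsum_eq
  rw [e] at lim1
  have := tendsto_nhds_unique lim1 lim2
  rw [tsum_mul_left] at this
  change _ * T z x = O z x * O z⁻¹ x at this
  rw [← this]
  field_simp

lemma T_neg_one {x : ℂ} (hx : ‖x‖ < 1) (hx0 : x ≠ 0) : T (-1) x * E (x ^ 2) = E x ^ 2 := by
  rw [triple hx hx0 (by norm_num), E_split hx]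
  norm_num
  ring

lemma T_one {x : ℂ} (hx : ‖x‖ < 1) (hx0 : x ≠ 0) : T 1 x * E (x ^ 2) = E (-x) ^ 2 := by
  rw [triple hx hx0 (by norm_num), E_split (x := -x) (by simpa using hx), O_neg]
  norm_num
  ring

lemma T_self {x : ℂ} (hx : ‖x‖ < 1) (hx0 : x ≠ 0) : T x x * E (x ^ 2) = 2 * E (x ^ 4) ^ 2 := by
  have hQ := sq_lt hx
  rw [triple hx hx0 hx0]
  have m1 : Multipliable fun n : ℕ => 1 + x * x ^ (2 * n + 1) := mult_O x hx
  have h1 : O x⁻¹ x = 2 * O x x := by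
    unfold O
    have e : ∀ n : ℕ, 1 + x⁻¹ * x ^ (2 * (n + 1) + 1) = 1 + x * x ^ (2 * n + 1) := by
      intro n
      have : x ^ (2 * (n + 1) + 1) = x * (x * x ^ (2 * n + 1)) := by ring
      rw [this, inv_mul_cancel_left₀ hx0]
    have m2 : Multipliable fun n : ℕ => 1 + x⁻¹ * x ^ (2 * (n + 1) + 1) := by
      simpa only [e] using m1
    rw [tprod_eq_zero_mul' (f := fun n : ℕ => 1 + x⁻¹ * x ^ (2 * n + 1)) m2]
    simp only [e]
    congr 1
    simp [hx0]
    norm_num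
  have h2 : E (x ^ 2) * O x x = E (x ^ 4) := by
    unfold E O
    rw [← (mult_E hQ).tprod_mul m1]
    congr 1; funext n
    ring
  rw [h1, ← h2]; ring

lemma hs_sq {g : ℤ → ℂ} (h : Summable fun j => ‖g j‖) :
    HasSum (fun j : ℤ × ℤ => g j.1 * g j.2) ((∑' j, g j) * ∑' j, g j) := by
  have b := (summable_mul_of_summable_norm h h).hasSum
  rw [tsum_mul_tsum_of_summable_norm h h]
  exact b

lemma T_hasSum {x z : ℂ} (hx : ‖x‖ < 1) (hx0 : x ≠ 0) (hz : z ≠ 0) :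
    HasSum (fun j : ℤ × ℤ => (z ^ j.1 * x ^ (j.1 ^ 2)) * (z ^ j.2 * x ^ (j.2 ^ 2)))
      (T z x * T z x) := by
  unfold T
  exact hs_sq (g := fun j : ℤ => z ^ j * x ^ (j ^ 2)) (summable_T hx hx0 hz)

lemma T_add {x : ℂ} (hx : ‖x‖ < 1) (hx0 : x ≠ 0) :
    T 1 x * T 1 x + T (-1) x * T (-1) x = 2 * (T 1 (x ^ 2) * T 1 (x ^ 2)) := by
  have h1 := (T_hasSum hx hx0 (z := 1) (by norm_num)).add
    (T_hasSum hx hx0 (z := -1) (by norm_num))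
  have h2 := (T_hasSum (sq_lt hx) (pow_ne_zero 2 hx0) (z := 1) (by norm_num)).mul_left 2
  have inj : Function.Injective fun a : ℤ × ℤ => (a.1 + a.2, a.1 - a.2) := by
    rintro ⟨a, b⟩ ⟨c, d⟩ h
    simp only [Prod.mk.injEq] at h ⊢
    omega
  rw [← inj.hasSum_iff] at h1
  · refine h1.unique ?_
    refine hs_congr h2 ?_ rfl
    rintro ⟨a, b⟩
    simp only [Function.comp, one_zpow, one_mul]
    have e1 : (-1 : ℂ) ^ (a + b) * (-1) ^ (a - b) = 1 := by
      rw [← zpow_add₀ (by norm_num)]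
      exact Even.neg_one_zpow ⟨a, by ring⟩
    have e2 : x ^ ((a + b) ^ 2) * x ^ ((a - b) ^ 2) = (x ^ 2) ^ (a ^ 2) * (x ^ 2) ^ (b ^ 2) := by
      rw [← zpow_add₀ hx0, ← zpow_natCast x 2, ← zpow_mul, ← zpow_mul, ← zpow_add₀ hx0]
      congr 1; push_cast; ring
    linear_combination (1 + (-1 : ℂ) ^ (a + b) * (-1) ^ (a - b)) * e2
      + (x ^ 2) ^ (a ^ 2) * (x ^ 2) ^ (b ^ 2) * e1
  · rintro ⟨m, n⟩ hmn
    have ho : Odd (m + n) := by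
      by_contra hc
      rw [Int.not_odd_iff_even] at hc
      obtain ⟨a, ha⟩ := hc
      exact hmn ⟨(a, m - a), by simp only [Prod.mk.injEq]; omega⟩
    have e1 : (-1 : ℂ) ^ m * (-1) ^ n = -1 := by
      rw [← zpow_add₀ (by norm_num)]
      exact Odd.neg_one_zpow ho
    simp only [one_zpow, one_mul]
    linear_combination x ^ (m ^ 2) * x ^ (n ^ 2) * e1

lemma T_sub {x : ℂ} (hx : ‖x‖ < 1) (hx0 : x ≠ 0) :
    T 1 x * T 1 x - T (-1) x * T (-1) x
      = 2 * x * (T (x ^ 2) (x ^ 2) * T (x ^ 2) (x ^ 2)) := by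
  have h1 := (T_hasSum hx hx0 (z := 1) (by norm_num)).sub
    (T_hasSum hx hx0 (z := -1) (by norm_num))
  have h2 := (T_hasSum (sq_lt hx) (pow_ne_zero 2 hx0) (z := x ^ 2)
    (pow_ne_zero 2 hx0)).mul_left (2 * x)
  have inj : Function.Injective fun a : ℤ × ℤ => (a.1 + a.2 + 1, a.1 - a.2) := by
    rintro ⟨a, b⟩ ⟨c, d⟩ h
    simp only [Prod.mk.injEq] at h ⊢
    omega
  rw [← inj.hasSum_iff] at h1
  · refine h1.unique ?_
    refine hs_congr h2 ?_ rfl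
    rintro ⟨a, b⟩
    simp only [Function.comp, one_zpow, one_mul]
    have e1 : (-1 : ℂ) ^ (a + b + 1) * (-1) ^ (a - b) = -1 := by
      rw [← zpow_add₀ (by norm_num)]
      exact Odd.neg_one_zpow ⟨a, by ring⟩
    have e2 : x ^ ((a + b + 1) ^ 2) * x ^ ((a - b) ^ 2)
        = x * ((x ^ 2) ^ a * (x ^ 2) ^ (a ^ 2) * ((x ^ 2) ^ b * (x ^ 2) ^ (b ^ 2))) := by
      have e3 : x ^ ((a + b + 1) ^ 2) * x ^ ((a - b) ^ 2) =
          x ^ ((1 : ℤ) + ((2 * a + 2 * a ^ 2) + (2 * b + 2 * b ^ 2))) := by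
        rw [← zpow_add₀ hx0]; congr 1; ring
      rw [e3]
      simp only [zpow_add₀ hx0, zpow_mul, zpow_one]
      norm_cast
    linear_combination (1 - (-1 : ℂ) ^ (a + b + 1) * (-1) ^ (a - b)) * e2
      - x * ((x ^ 2) ^ a * (x ^ 2) ^ (a ^ 2) * ((x ^ 2) ^ b * (x ^ 2) ^ (b ^ 2))) * e1
  · rintro ⟨m, n⟩ hmn
    have ho : Even (m + n) := by
      by_contra hc
      rw [Int.not_even_iff_odd] at hc
      obtain ⟨a, ha⟩ := hc
      exact hmn ⟨(a, a - n), by simp only [Prod.mk.injEq]; omega⟩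
    have e1 : (-1 : ℂ) ^ m * (-1) ^ n = 1 := by
      rw [← zpow_add₀ (by norm_num)]
      exact Even.neg_one_zpow ho
    simp only [one_zpow, one_mul]
    linear_combination - (x ^ (m ^ 2) * x ^ (n ^ 2)) * e1

/-- The Jacobi aequatio identica satis abstrusa. -/
lemma H2 {x : ℂ} (hx : ‖x‖ < 1) (hx0 : x ≠ 0) :
    E (-x) ^ 8 = E x ^ 8 + 16 * x * E (x ^ 4) ^ 8 := by
  have hQ := sq_lt hx
  have hQ0 : x ^ 2 ≠ 0 := pow_ne_zero 2 hx0
  have hw := E_ne hQ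
  have ht : E (x ^ 4) ≠ 0 := by
    have := E_ne (sq_lt hQ); rwa [← pow_mul] at this
  have a := T_one hx hx0
  have b := T_neg_one hx hx0
  have c := T_add hx hx0
  have d := T_sub hx hx0
  have e := T_one hQ hQ0
  have g := T_self hQ hQ0
  have h := H1 hQ
  simp only [← pow_mul] at e g h
  norm_num at e g h
  have h8 : (T 1 (x ^ 2) * T (x ^ 2) (x ^ 2)) * E (x ^ 2) ^ 2 = 2 * E (x ^ 4) ^ 4 := by
    apply mul_right_cancel₀ (pow_ne_zero 2 ht)
    calc _ = (T 1 (x ^ 2) * E (x ^ 4)) * (T (x ^ 2) (x ^ 2) * E (x ^ 4)) * E (x ^ 2) ^ 2 := by ring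
      _ = 2 * (E (x ^ 8) * E (x ^ 2) * E (-x ^ 2)) ^ 2 := by rw [e, g]; ring
      _ = _ := by rw [h]; ring
  have h9 : T 1 x ^ 4 - T (-1) x ^ 4 = 4 * x * (T 1 (x ^ 2) * T (x ^ 2) (x ^ 2)) ^ 2 := by
    linear_combination (T 1 x * T 1 x - T (-1) x * T (-1) x) * c
      + 2 * (T 1 (x ^ 2) * T 1 (x ^ 2)) * d
  calc E (-x) ^ 8 = (E (-x) ^ 2) ^ 4 := by ring
    _ = (T (-1) x * E (x ^ 2)) ^ 4 + (T 1 x ^ 4 - T (-1) x ^ 4) * E (x ^ 2) ^ 4 := by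
      rw [← a]; ring
    _ = (E x ^ 2) ^ 4 + 4 * x * ((T 1 (x ^ 2) * T (x ^ 2) (x ^ 2)) * E (x ^ 2) ^ 2) ^ 2 := by
      rw [h9, b]; ring
    _ = _ := by rw [h8]; ring

lemma Δ_eq {τ y : ℂ} (hy : ‖y‖ < 1) (h : Complex.exp (2 * Real.pi * Complex.I * τ) = y) :
    Δ τ = y * E y ^ 24 := by
  unfold Δ E
  rw [h, (mult_E hy).tprod_pow]

end HeckeAux

open HeckeAux
/-- For every `τ` in the upper half-plane, the Hecke-operator identity
`(1/2)·(f(τ/2) + f((τ+1)/2)) = 2¹¹·f(τ)² + 24·f(τ)` holds for `f(τ) = Δ(2τ)/Δ(τ)`. -/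
theorem hecke_operator_identity (τ : ℂ) (hτ : 0 < τ.im) :
    (1 / 2 : ℂ) * (f (τ / 2) + f ((τ + 1) / 2)) = 2 ^ 11 * f τ ^ 2 + 24 * f τ := by
  obtain ⟨p, hp⟩ : ∃ p, p = Complex.exp (Real.pi * Complex.I * τ) := ⟨_, rfl⟩
  have hp0 : p ≠ 0 := hp ▸ Complex.exp_ne_zero _
  have hp1 : ‖p‖ < 1 := by
    rw [hp, Complex.norm_exp, Real.exp_lt_one_iff]
    have : (Real.pi * Complex.I * τ).re = - (Real.pi * τ.im) := by simp
    rw [this]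
    have := mul_pos Real.pi_pos hτ
    linarith
  have hn1 : ‖-p‖ < 1 := by simpa using hp1
  have hQ := sq_lt hp1
  have h4 : ‖p ^ 4‖ < 1 := by
    have := sq_lt hQ; rwa [← pow_mul] at this
  have d1 : Δ (τ / 2) = p * E p ^ 24 := Δ_eq hp1 (by rw [hp]; congr 1; ring)
  have d2 : Δ τ = p ^ 2 * E (p ^ 2) ^ 24 :=
    Δ_eq hQ (by rw [hp, ← Complex.exp_nat_mul]; congr 1; push_cast; ring)
  have d3 : Δ (2 * τ) = p ^ 4 * E (p ^ 4) ^ 24 :=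
    Δ_eq h4 (by rw [hp, ← Complex.exp_nat_mul]; congr 1; push_cast; ring)
  have d4 : Δ ((τ + 1) / 2) = -p * E (-p) ^ 24 := Δ_eq hn1 (by
    rw [show 2 * (Real.pi : ℂ) * I * ((τ + 1) / 2) = Real.pi * I * τ + Real.pi * I by ring,
      Complex.exp_add, Complex.exp_pi_mul_I, hp]; ring)
  have d5 : Δ (τ + 1) = p ^ 2 * E (p ^ 2) ^ 24 := Δ_eq hQ (by
    rw [show 2 * (Real.pi : ℂ) * I * (τ + 1) = 2 * (Real.pi * I * τ) + 2 * Real.pi * I by ring,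
      Complex.exp_add, Complex.exp_two_pi_mul_I, hp, ← Complex.exp_nat_mul]; simp)
  have g1 := H1 hp1
  have g2 := H2 hp1 hp0
  have n1 := E_ne hp1
  have n2 := E_ne hn1
  have n3 := E_ne hQ
  have n4 := E_ne h4
  unfold f
  rw [show 2 * (τ / 2) = τ by ring, show 2 * ((τ + 1) / 2) = τ + 1 by ring, d1, d2, d3, d4, d5]
  generalize E p = u at *
  generalize E (-p) = v at *
  generalize E (p ^ 2) = w at *
  generalize E (p ^ 4) = t at *
  have k1 : p ^ 2 * w ^ 24 / (p * u ^ 24) = p * (t * v) ^ 24 / w ^ 48 := by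
    rw [div_eq_div_iff (by simp [hp0, n1]) (by simp [n3])]
    have : w ^ 72 = (t * u * v) ^ 24 := by rw [g1]; ring
    linear_combination p ^ 2 * this
  have k2 : p ^ 2 * w ^ 24 / (-p * v ^ 24) = -(p * (t * u) ^ 24) / w ^ 48 := by
    rw [div_eq_div_iff (by simp [hp0, n2]) (by simp [n3])]
    have : w ^ 72 = (t * u * v) ^ 24 := by rw [g1]; ring
    linear_combination p ^ 2 * this
  rw [k1, k2]
  have k3 : v ^ 24 - u ^ 24 = 2 ^ 12 * p ^ 3 * t ^ 24 + 48 * p * w ^ 24 := by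
    have h8 : v ^ 8 - u ^ 8 = 16 * p * t ^ 8 := by rw [g2]; ring
    calc v ^ 24 - u ^ 24 = (v ^ 8 - u ^ 8) * ((v ^ 8 - u ^ 8) ^ 2 + 3 * (u * v) ^ 8) := by ring
      _ = 2 ^ 12 * p ^ 3 * t ^ 24 + 48 * p * (t * u * v) ^ 8 := by rw [h8]; ring
      _ = _ := by rw [g1]; ring
  have k4 : p ^ 4 * t ^ 24 / (p ^ 2 * w ^ 24) = p ^ 2 * t ^ 24 * w ^ 24 / w ^ 48 := by
    rw [div_eq_div_iff (by simp [hp0, n3]) (by simp [n3])]; ring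
  have k5 : (p ^ 4 * t ^ 24 / (p ^ 2 * w ^ 24)) ^ 2 = p ^ 4 * t ^ 48 / w ^ 48 := by
    rw [div_pow, div_eq_div_iff (by simp [hp0, n3]) (by simp [n3])]; ring
  rw [k5, k4]
  linear_combination (p * t ^ 24 / w ^ 48 / 2) * k3
end

section
/- For every τ in the complex upper half-plane ℍ, the function f(τ) = Δ(2τ)/Δ(τ) satisfies (1/2)·( f(τ/2) − f(τ)/f(τ/2) ) = 24·f(τ) + 2^11·f(τ)². -/
open Complex

noncomputable def Phi (y Q : ℂ) : ℂ := ∏' k : ℕ, (1 + y * Q ^ k)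

lemma summ_yQ (y : ℂ) {Q : ℂ} (hQ : ‖Q‖ < 1) : Summable fun k : ℕ => ‖y * Q ^ k‖ := by
  simp only [norm_mul, norm_pow]
  exact (summable_geometric_of_lt_one (norm_nonneg _) hQ).mul_left _

lemma mult_Phi (y : ℂ) {Q : ℂ} (hQ : ‖Q‖ < 1) : Multipliable fun k : ℕ => (1 + y * Q ^ k) :=
  multipliable_one_add_of_summable (summ_yQ y hQ)

lemma Phi_ne_zero (y : ℂ) {Q : ℂ} (hQ : ‖Q‖ < 1) (hy : ‖y‖ < 1) : Phi y Q ≠ 0 := by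
  refine tprod_one_add_ne_zero_of_summable (f := fun k : ℕ => y * Q ^ k) ?_ (summ_yQ y hQ)
  intro k h
  have h1 : y * Q ^ k = -1 := by linear_combination h
  have h2 : ‖y * Q ^ k‖ = 1 := by rw [h1]; simp
  rw [norm_mul, norm_pow] at h2
  have : ‖Q‖ ^ k ≤ 1 := pow_le_one₀ (norm_nonneg _) hQ.le
  nlinarith [norm_nonneg y, pow_nonneg (norm_nonneg Q) k]

lemma Phi_step (y : ℂ) {Q : ℂ} (hQ : ‖Q‖ < 1) : Phi y Q = (1 + y) * Phi (y * Q) Q := by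
  unfold Phi
  have e : (fun k : ℕ => 1 + y * Q ^ (k + 1)) = fun k : ℕ => 1 + y * Q * Q ^ k := by
    ext k; ring
  rw [tprod_eq_zero_mul' (f := fun k : ℕ => 1 + y * Q ^ k) (by rw [e]; exact mult_Phi (y * Q) hQ),
    e]
  simp

lemma normsq {Q : ℂ} (hQ : ‖Q‖ < 1) : ‖Q ^ 2‖ < 1 := by
  rw [norm_pow]; exact pow_lt_one₀ (norm_nonneg _) hQ (by norm_num)

lemma Phi_neg (y : ℂ) {Q : ℂ} (hQ : ‖Q‖ < 1) : Phi y Q * Phi (-y) Q = Phi (-y ^ 2) (Q ^ 2) := by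
  unfold Phi
  rw [← (mult_Phi y hQ).tprod_mul (mult_Phi (-y) hQ)]
  congr 1; ext k; ring

lemma Phi_split (y : ℂ) {Q : ℂ} (hQ : ‖Q‖ < 1) :
    Phi y Q = Phi y (Q ^ 2) * Phi (y * Q) (Q ^ 2) := by
  have e : (fun k : ℕ => 1 + y * Q ^ (2 * k)) = fun k : ℕ => 1 + y * (Q ^ 2) ^ k := by
    ext k; ring
  have o : (fun k : ℕ => 1 + y * Q ^ (2 * k + 1)) = fun k : ℕ => 1 + y * Q * (Q ^ 2) ^ k := by
    ext k; ring
  unfold Phi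
  rw [← e, ← o, tprod_even_mul_odd (f := fun k : ℕ => 1 + y * Q ^ k)]
  · rw [e]; exact mult_Phi _ (normsq hQ)
  · rw [o]; exact mult_Phi _ (normsq hQ)

lemma Phi_tendsto (y : ℂ) {Q : ℂ} (hQ : ‖Q‖ < 1) :
    Filter.Tendsto (fun n => ∏ k ∈ Finset.range n, (1 + y * Q ^ k)) Filter.atTop
      (nhds (Phi y Q)) :=
  (mult_Phi y hQ).hasProd.tendsto_prod_nat

lemma summ_real {r s : ℝ} (hr0 : 0 < r) (hr : r < 1) (hs : 0 < s) :
    Summable fun j : ℤ => r ^ (j ^ 2) * s ^ j := by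
  have h := (summable_jacobiTheta₂_term_iff (-I * Real.log s / (2 * Real.pi))
    (-I * Real.log r / Real.pi)).2 (by
      have : (-I * Real.log r / Real.pi : ℂ) = ((-(Real.log r) / Real.pi : ℝ) : ℂ) * I := by
        push_cast; ring
      rw [this, Complex.im_ofReal_mul]
      simp only [I_im, mul_one]
      exact div_pos (by linarith [Real.log_neg hr0 hr]) Real.pi_pos)
  have h2 := h.norm
  refine h2.congr fun j => ?_
  have hpi : (Real.pi : ℂ) ≠ 0 := by exact_mod_cast Real.pi_ne_zero
  have : jacobiTheta₂_term j (-I * Real.log s / (2 * Real.pi)) (-I * Real.log r / Real.pi)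
      = ((r ^ (j ^ 2) * s ^ j : ℝ) : ℂ) := by
    have e1 : r ^ (j ^ 2) = Real.exp (j ^ 2 * Real.log r) := by
      rw [← Real.rpow_intCast, Real.rpow_def_of_pos hr0, mul_comm]; push_cast; rfl
    have e2 : s ^ j = Real.exp (j * Real.log s) := by
      rw [← Real.rpow_intCast, Real.rpow_def_of_pos hs, mul_comm]
    rw [e1, e2, ← Real.exp_add, Complex.ofReal_exp, jacobiTheta₂_term]
    congr 1
    push_cast
    field_simp
    linear_combination (-(2*(j:ℂ) * Real.log s) /2 - (j:ℂ)^2 * Real.log r) * I_sq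
  rw [this, Complex.norm_real, Real.norm_of_nonneg (by positivity)]

lemma summ_theta {x z : ℂ} (hx0 : x ≠ 0) (hx : ‖x‖ < 1) (hz : z ≠ 0) :
    Summable fun j : ℤ => ‖x ^ (j ^ 2) * z ^ j‖ := by
  simp only [norm_mul, norm_zpow]
  exact summ_real (norm_pos_iff.2 hx0) hx (norm_pos_iff.2 hz)

noncomputable def qp (Q : ℂ) (n : ℕ) : ℂ := ∏ k ∈ Finset.range n, (1 - Q ^ (k + 1))

noncomputable def DD (Q : ℂ) (m : ℤ) : ℂ := if m < 0 then 0 else (qp Q m.toNat)⁻¹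

lemma one_sub_ne {Q : ℂ} (hQ : ‖Q‖ < 1) (k : ℕ) : 1 - Q ^ (k + 1) ≠ 0 := by
  intro h
  have h1 : ‖Q ^ (k + 1)‖ = 1 := by rw [← sub_eq_zero.1 h]; simp
  rw [norm_pow] at h1
  have := pow_lt_one₀ (norm_nonneg Q) hQ (Nat.succ_ne_zero k)
  simp at this
  linarith

lemma qp_ne {Q : ℂ} (hQ : ‖Q‖ < 1) (n : ℕ) : qp Q n ≠ 0 :=
  Finset.prod_ne_zero_iff.2 fun k _ => one_sub_ne hQ k

lemma qp_succ (Q : ℂ) (n : ℕ) : qp Q (n + 1) = qp Q n * (1 - Q ^ (n + 1)) :=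
  Finset.prod_range_succ _ _

lemma DD_step {Q : ℂ} (hQ : ‖Q‖ < 1) (m : ℤ) :
    DD Q m = (1 - Q ^ (m + 1)) * DD Q (m + 1) := by
  unfold DD
  rcases lt_trichotomy m (-1) with h | h | h
  · rw [if_pos (by omega), if_pos (by omega)]; simp
  · subst h; simp
  · obtain ⟨n, rfl⟩ := Int.eq_ofNat_of_zero_le (show 0 ≤ m by omega)
    rw [if_neg (by omega), if_neg (by omega)]
    have e : ((n : ℤ) + 1).toNat = n + 1 := by omega
    have e2 : Q ^ ((n : ℤ) + 1) = Q ^ (n + 1) := by exact_mod_cast zpow_natCast Q (n + 1)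
    rw [e, e2, qp_succ, Int.toNat_natCast]
    have := one_sub_ne hQ n
    have := qp_ne hQ n
    field_simp

noncomputable def cc (x : ℂ) (n : ℕ) (j : ℤ) : ℂ :=
  x ^ (j ^ 2) * qp (x ^ 2) (2 * n) * DD (x ^ 2) (n - j) * DD (x ^ 2) (n + j)

lemma cc_step {x : ℂ} (hx0 : x ≠ 0) (hx : ‖x‖ < 1) (n : ℕ) (j : ℤ) :
    cc x (n + 1) j = cc x n j * (1 + x ^ (2 * (2 * n + 1))) +
      x ^ (2 * n + 1) * (cc x n (j - 1) + cc x n (j + 1)) := by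
  have hQ := normsq hx
  unfold cc
  have a1 : DD (x ^ 2) (n - j) = (1 - (x ^ 2) ^ (n - j + 1 : ℤ)) * DD (x ^ 2) (n - j + 1) :=
    DD_step hQ _
  have a2 : DD (x ^ 2) (n + j) = (1 - (x ^ 2) ^ (n + j + 1 : ℤ)) * DD (x ^ 2) (n + j + 1) :=
    DD_step hQ _
  have a3 : DD (x ^ 2) (n - (j + 1)) = (1 - (x ^ 2) ^ (n - j : ℤ)) * DD (x ^ 2) (n - j) := by
    have := DD_step hQ (n - (j + 1))
    rwa [show (n : ℤ) - (j + 1) + 1 = n - j by ring] at this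
  have a4 : DD (x ^ 2) (n + (j - 1)) = (1 - (x ^ 2) ^ (n + j : ℤ)) * DD (x ^ 2) (n + j) := by
    have := DD_step hQ (n + (j - 1))
    rwa [show (n : ℤ) + (j - 1) + 1 = n + j by ring] at this
  rw [a3, a4, a1, a2, show (n : ℤ) - (j - 1) = n - j + 1 by ring,
    show (n : ℤ) + (j + 1) = n + j + 1 by ring, show ((n + 1 : ℕ) : ℤ) - j = n - j + 1 by push_cast; ring,
    show ((n + 1 : ℕ) : ℤ) + j = n + j + 1 by push_cast; ring,
    show 2 * (n + 1) = 2 * n + 1 + 1 by ring, qp_succ, qp_succ]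
  generalize DD (x ^ 2) (n - j + 1) = u
  generalize DD (x ^ 2) (n + j + 1) = w
  have hQ0 : x ^ 2 ≠ 0 := pow_ne_zero _ hx0
  have e1 : x ^ ((j - 1) ^ 2) = x ^ (j ^ 2) * x / (x ^ j) ^ 2 := by
    rw [show (j - 1) ^ 2 = j ^ 2 + 1 - j * 2 by ring, zpow_sub₀ hx0, zpow_add₀ hx0, zpow_mul]
    simp; try norm_cast
  have e2 : x ^ ((j + 1) ^ 2) = x ^ (j ^ 2) * x * (x ^ j) ^ 2 := by
    rw [show (j + 1) ^ 2 = j ^ 2 + 1 + j * 2 by ring, zpow_add₀ hx0, zpow_add₀ hx0, zpow_mul]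
    simp; try norm_cast
  have e3 : (x ^ 2) ^ j = (x ^ j) ^ 2 := by
    rw [← zpow_natCast, ← zpow_natCast, ← zpow_mul, ← zpow_mul, mul_comm]
  rw [e1, e2, zpow_add₀ hQ0, zpow_add₀ hQ0, zpow_sub₀ hQ0, zpow_add₀ hQ0, e3]
  have hj : x ^ j ≠ 0 := zpow_ne_zero _ hx0
  generalize x ^ j = b at *
  simp only [zpow_natCast, zpow_one]
  field_simp
  ring

lemma finite_triple {x z : ℂ} (hx0 : x ≠ 0) (hx : ‖x‖ < 1) (hz : z ≠ 0) (n : ℕ) :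
    HasSum (fun j : ℤ => cc x n j * z ^ j)
      ((∏ k ∈ Finset.range n, (1 + x * z * (x ^ 2) ^ k)) *
        ∏ k ∈ Finset.range n, (1 + x / z * (x ^ 2) ^ k)) := by
  induction n with
  | zero =>
    have := hasSum_single (f := fun j : ℤ => cc x 0 j * z ^ j) 0 (by
      intro j hj
      unfold cc DD
      rcases lt_or_gt_of_ne hj with h | h
      · simp [h]
      · simp [h])
    simpa [cc, DD, qp] using this
  | succ n ih =>
    have h1 := (Equiv.hasSum_iff (Equiv.subRight (1 : ℤ))).2 ih
    have h2 := (Equiv.hasSum_iff (Equiv.addRight (1 : ℤ))).2 ih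
    have h := (ih.mul_left (1 + x ^ (2 * (2 * n + 1)))).add
      ((h1.mul_left (x ^ (2 * n + 1) * z)).add (h2.mul_left (x ^ (2 * n + 1) / z)))
    have ef : ∀ j : ℤ, cc x (n + 1) j * z ^ j = (1 + x ^ (2 * (2 * n + 1))) * (cc x n j * z ^ j) +
        (x ^ (2 * n + 1) * z * (cc x n (j - 1) * z ^ (j - 1)) +
          x ^ (2 * n + 1) / z * (cc x n (j + 1) * z ^ (j + 1))) := by
      intro j
      rw [cc_step hx0 hx, zpow_sub₀ hz, zpow_add₀ hz, zpow_one]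
      field_simp
    rw [funext ef, Finset.prod_range_succ, Finset.prod_range_succ]
    convert h using 1
    · rfl
    · rfl
    · generalize ∏ k ∈ Finset.range n, (1 + x * z * (x ^ 2) ^ k) = S
      generalize ∏ k ∈ Finset.range n, (1 + x / z * (x ^ 2) ^ k) = T
      field_simp
      ring

lemma qp_tendsto {Q : ℂ} (hQ : ‖Q‖ < 1) :
    Filter.Tendsto (qp Q) Filter.atTop (nhds (Phi (-Q) Q)) := by
  have := Phi_tendsto (-Q) hQ
  refine this.congr fun n => ?_
  unfold qp
  refine Finset.prod_congr rfl fun k _ => ?_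
  ring

lemma bdd_of_tendsto {u : ℕ → ℂ} {a : ℂ} (h : Filter.Tendsto u Filter.atTop (nhds a)) :
    ∃ M, 0 ≤ M ∧ ∀ n, ‖u n‖ ≤ M := by
  obtain ⟨M, hM⟩ := h.norm.bddAbove_range
  have : ∀ n, ‖u n‖ ≤ M := fun n => hM ⟨n, rfl⟩
  exact ⟨M, (norm_nonneg _).trans (this 0), this⟩

lemma triple {x z : ℂ} (hx0 : x ≠ 0) (hx : ‖x‖ < 1) (hz : z ≠ 0) :
    Phi (x * z) (x ^ 2) * Phi (x / z) (x ^ 2) * Phi (-x ^ 2) (x ^ 2)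
      = ∑' j : ℤ, x ^ (j ^ 2) * z ^ j := by
  have hQ := normsq hx
  have hE : Phi (-x ^ 2) (x ^ 2) ≠ 0 := Phi_ne_zero _ hQ (by rwa [norm_neg])
  have hq := qp_tendsto hQ
  have hqi := hq.inv₀ hE
  obtain ⟨M, hM0, hM⟩ := bdd_of_tendsto hq
  obtain ⟨N, hN0, hN⟩ := bdd_of_tendsto hqi
  have hD : ∀ m : ℤ, ‖DD (x ^ 2) m‖ ≤ N := by
    intro m
    unfold DD
    split_ifs
    · simpa using hN0
    · exact hN _
  have hDt : Filter.Tendsto (DD (x ^ 2)) Filter.atTop (nhds (Phi (-x ^ 2) (x ^ 2))⁻¹) := by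
    have ht : Filter.Tendsto Int.toNat Filter.atTop Filter.atTop :=
      Filter.tendsto_atTop.2 fun b => by
        filter_upwards [Filter.eventually_ge_atTop (b : ℤ)] with m hm
        omega
    refine (hqi.comp ht).congr' ?_
    filter_upwards [Filter.eventually_ge_atTop 0] with m hm
    simp [DD, not_lt.2 hm]
  have key := tendsto_tsum_of_dominated_convergence (𝓕 := Filter.atTop)
    (f := fun (n : ℕ) (j : ℤ) => cc x n j * z ^ j)
    (g := fun j : ℤ => (x ^ (j ^ 2) * z ^ j) * (Phi (-x ^ 2) (x ^ 2))⁻¹)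
    (bound := fun j : ℤ => ‖x ^ (j ^ 2) * z ^ j‖ * (M * N * N))
    ((summ_theta hx0 hx hz).mul_right _) ?_ ?_
  · have h2 := (Phi_tendsto (x * z) hQ).mul (Phi_tendsto (x / z) hQ)
    have h3 := h2.congr fun n => (finite_triple hx0 hx hz n).tsum_eq.symm
    have := tendsto_nhds_unique h3 key
    rw [this, tsum_mul_right, mul_assoc, inv_mul_cancel₀ hE, mul_one]
  · intro j
    have t1 : Filter.Tendsto (fun n : ℕ => (n : ℤ) - j) Filter.atTop Filter.atTop :=
      Filter.tendsto_atTop_add_const_right _ (-j) tendsto_natCast_atTop_atTop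
    have t2 : Filter.Tendsto (fun n : ℕ => (n : ℤ) + j) Filter.atTop Filter.atTop :=
      Filter.tendsto_atTop_add_const_right _ j tendsto_natCast_atTop_atTop
    have t3 : Filter.Tendsto (fun n : ℕ => 2 * n) Filter.atTop Filter.atTop :=
      Filter.tendsto_atTop.2 fun b => by
        filter_upwards [Filter.eventually_ge_atTop b] with m hm
        omega
    have := ((((hq.comp t3).const_mul (x ^ (j ^ 2))).mul (hDt.comp t1)).mul
      (hDt.comp t2)).mul_const (z ^ j)
    have e : x ^ (j ^ 2) * z ^ j * (Phi (-x ^ 2) (x ^ 2))⁻¹ = x ^ (j ^ 2) * Phi (-x ^ 2) (x ^ 2) *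
        (Phi (-x ^ 2) (x ^ 2))⁻¹ * (Phi (-x ^ 2) (x ^ 2))⁻¹ * z ^ j := by
      rw [mul_assoc (x ^ (j ^ 2)) (Phi _ _) (Phi (-x ^ 2) (x ^ 2))⁻¹, mul_inv_cancel₀ hE]
      ring
    rw [e]
    exact this
  · refine Filter.Eventually.of_forall fun n j => ?_
    unfold cc
    simp only [norm_mul]
    have a := hM (2 * n)
    have b := hD (n - j)
    have c := hD (n + j)
    calc _ = ‖x ^ (j ^ 2)‖ * ‖z ^ j‖ * (‖qp (x ^ 2) (2 * n)‖ * ‖DD (x ^ 2) (n - j)‖ * ‖DD (x ^ 2) (n + j)‖) := by ring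
      _ ≤ _ := by gcongr

/-- even part -/
lemma theta_add {x : ℂ} (hx0 : x ≠ 0) (hx : ‖x‖ < 1) :
    (∑' j : ℤ, x ^ (j ^ 2) * (1 : ℂ) ^ j) ^ 2 + (∑' j : ℤ, x ^ (j ^ 2) * (-1 : ℂ) ^ j) ^ 2
      = 2 * (∑' j : ℤ, (x ^ 2) ^ (j ^ 2) * (1 : ℂ) ^ j) ^ 2 := by
  have s1 := summ_theta hx0 hx (z := 1) one_ne_zero
  have s2 := summ_theta hx0 hx (z := -1) (by norm_num)
  have s3 := summ_theta (pow_ne_zero 2 hx0) (normsq hx) (z := 1) one_ne_zero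
  rw [sq, sq, sq, tsum_mul_tsum_of_summable_norm s1 s1, tsum_mul_tsum_of_summable_norm s2 s2,
    tsum_mul_tsum_of_summable_norm s3 s3,
    ← (summable_mul_of_summable_norm s1 s1).tsum_add (summable_mul_of_summable_norm s2 s2),
    ← tsum_mul_left]
  let g : ℤ × ℤ → ℤ × ℤ := fun p => (p.1 + p.2, p.1 - p.2)
  have hg : Function.Injective g := by
    rintro ⟨a, b⟩ ⟨c, d⟩ h
    simp only [g, Prod.mk.injEq] at h ⊢
    omega
  rw [← hg.tsum_eq]
  · refine tsum_congr fun p => ?_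
    obtain ⟨a, b⟩ := p
    simp only [g, one_zpow, mul_one]
    have e : (-1 : ℂ) ^ (a + b) * (-1 : ℂ) ^ (a - b) = 1 := by
      rw [← zpow_add₀ (by norm_num)]
      exact Even.neg_one_zpow ⟨a, by ring⟩
    have e2 : x ^ ((a + b) ^ 2) * x ^ ((a - b) ^ 2) = (x ^ 2) ^ (a ^ 2) * (x ^ 2) ^ (b ^ 2) := by
      rw [← zpow_natCast x 2, ← zpow_mul, ← zpow_mul, ← zpow_add₀ hx0, ← zpow_add₀ hx0]
      congr 1; push_cast; ring
    linear_combination (x ^ ((a + b) ^ 2) * x ^ ((a - b) ^ 2)) * e + 2 * e2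
  · rintro ⟨m, n⟩ h
    by_contra hc
    apply h
    have ho : Odd (m + n) := by
      by_contra he
      rw [Int.not_odd_iff_even] at he
      obtain ⟨k, hk⟩ := he
      exact hc ⟨(k, m - k), by simp only [g, Prod.mk.injEq]; omega⟩
    have e : (-1 : ℂ) ^ m * (-1 : ℂ) ^ n = -1 := by
      rw [← zpow_add₀ (by norm_num)]
      exact ho.neg_one_zpow
    simp only [one_zpow, mul_one]
    linear_combination (x ^ (m ^ 2) * x ^ (n ^ 2)) * e

/-- odd part -/
lemma theta_sub {x : ℂ} (hx0 : x ≠ 0) (hx : ‖x‖ < 1) :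
    (∑' j : ℤ, x ^ (j ^ 2) * (1 : ℂ) ^ j) ^ 2 - (∑' j : ℤ, x ^ (j ^ 2) * (-1 : ℂ) ^ j) ^ 2
      = 2 * x * (∑' j : ℤ, (x ^ 2) ^ (j ^ 2) * (x ^ 2) ^ j) ^ 2 := by
  have s1 := summ_theta hx0 hx (z := 1) one_ne_zero
  have s2 := summ_theta hx0 hx (z := -1) (by norm_num)
  have s3 := summ_theta (pow_ne_zero 2 hx0) (normsq hx) (z := x ^ 2) (pow_ne_zero 2 hx0)
  rw [sq, sq, sq, tsum_mul_tsum_of_summable_norm s1 s1, tsum_mul_tsum_of_summable_norm s2 s2,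
    tsum_mul_tsum_of_summable_norm s3 s3,
    ← (summable_mul_of_summable_norm s1 s1).tsum_sub (summable_mul_of_summable_norm s2 s2),
    ← tsum_mul_left]
  let g : ℤ × ℤ → ℤ × ℤ := fun p => (p.1 + p.2 + 1, p.1 - p.2)
  have hg : Function.Injective g := by
    rintro ⟨a, b⟩ ⟨c, d⟩ h
    simp only [g, Prod.mk.injEq] at h ⊢
    omega
  rw [← hg.tsum_eq]
  · refine tsum_congr fun p => ?_
    obtain ⟨a, b⟩ := p
    simp only [g, one_zpow, mul_one]
    have e : (-1 : ℂ) ^ (a + b + 1) * (-1 : ℂ) ^ (a - b) = -1 := by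
      rw [← zpow_add₀ (by norm_num)]
      exact Odd.neg_one_zpow ⟨a, by ring⟩
    have e2 : x ^ ((a + b + 1) ^ 2) * x ^ ((a - b) ^ 2)
        = x * ((x ^ 2) ^ (a ^ 2) * (x ^ 2) ^ a * ((x ^ 2) ^ (b ^ 2) * (x ^ 2) ^ b)) := by
      rw [← zpow_natCast x 2, ← zpow_mul, ← zpow_mul, ← zpow_mul, ← zpow_mul, ← zpow_add₀ hx0,
        ← zpow_add₀ hx0, ← zpow_add₀ hx0, ← zpow_add₀ hx0, ← zpow_one_add₀ hx0]
      congr 1; push_cast; ring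
    linear_combination -(x ^ ((a + b + 1) ^ 2) * x ^ ((a - b) ^ 2)) * e + 2 * e2
  · rintro ⟨m, n⟩ h
    by_contra hc
    apply h
    have ho : Even (m + n) := by
      by_contra he
      rw [Int.not_even_iff_odd] at he
      obtain ⟨k, hk⟩ := he
      exact hc ⟨(k, k - n), by simp only [g, Prod.mk.injEq]; omega⟩
    have e : (-1 : ℂ) ^ m * (-1 : ℂ) ^ n = 1 := by
      rw [← zpow_add₀ (by norm_num)]
      exact ho.neg_one_zpow
    simp only [one_zpow, mul_one]
    linear_combination -(x ^ (m ^ 2) * x ^ (n ^ 2)) * e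

lemma psi_prod {x : ℂ} (hx0 : x ≠ 0) (hx : ‖x‖ < 1) :
    ∑' j : ℤ, x ^ (j ^ 2) * x ^ j = 2 * Phi (x ^ 2) (x ^ 2) ^ 2 * Phi (-x ^ 2) (x ^ 2) := by
  rw [← triple hx0 hx hx0, div_self hx0, Phi_step 1 (normsq hx), one_mul, ← sq x]
  ring

lemma E_sq {x : ℂ} (hx : ‖x‖ < 1) : Phi (-(x ^ 2) ^ 2) ((x ^ 2) ^ 2)
    = Phi (x ^ 2) (x ^ 2) * Phi (-x ^ 2) (x ^ 2) := (Phi_neg (x ^ 2) (normsq hx)).symm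

/-- Jacobi's aequatio identica satis abstrusa. -/
lemma jacobi {x : ℂ} (hx0 : x ≠ 0) (hx : ‖x‖ < 1) :
    Phi x (x ^ 2) ^ 8 - Phi (-x) (x ^ 2) ^ 8 = 16 * x * Phi (x ^ 2) (x ^ 2) ^ 8 := by
  have hQ := normsq hx
  have hE : Phi (-x ^ 2) (x ^ 2) ≠ 0 := Phi_ne_zero _ hQ (by rwa [norm_neg])
  have h1 := theta_add hx0 hx
  have h2 := theta_sub hx0 hx
  have hx20 : x ^ 2 ≠ 0 := pow_ne_zero 2 hx0
  rw [psi_prod hx20 hQ, E_sq hx, ← triple hx0 hx one_ne_zero,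
    ← triple hx0 hx (by norm_num : (-1 : ℂ) ≠ 0)] at h2
  rw [← triple hx20 hQ one_ne_zero, E_sq hx, ← triple hx0 hx one_ne_zero,
    ← triple hx0 hx (by norm_num : (-1 : ℂ) ≠ 0)] at h1
  simp only [mul_one, div_one, mul_neg, div_neg] at h1 h2
  have h3 : Phi (x ^ 2) (x ^ 2) = Phi (x ^ 2) ((x ^ 2) ^ 2) * Phi ((x ^ 2) ^ 2) ((x ^ 2) ^ 2) := by
    have := Phi_split (x ^ 2) hQ
    rwa [← sq] at this
  generalize Phi x (x ^ 2) = A at *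
  generalize Phi (-x) (x ^ 2) = B at *
  generalize Phi (x ^ 2) ((x ^ 2) ^ 2) = A2 at *
  generalize Phi ((x ^ 2) ^ 2) ((x ^ 2) ^ 2) = C2 at *
  generalize Phi (x ^ 2) (x ^ 2) = C at *
  generalize Phi (-x ^ 2) (x ^ 2) = E at *
  have h4 : (A ^ 8 - B ^ 8) * E ^ 4 = (16 * x * C ^ 8) * E ^ 4 := by
    have : (A ^ 8 - B ^ 8) * E ^ 4 = 16 * x * (A2 * C2) ^ 4 * C ^ 4 * E ^ 4 := by
      calc _ = ((A * A * E) ^ 2 + (B * B * E) ^ 2) * ((A * A * E) ^ 2 - (B * B * E) ^ 2) := by ring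
        _ = _ := by rw [h1, h2]; ring
    rw [this, ← h3]; ring
  exact mul_right_cancel₀ (pow_ne_zero 4 hE) h4

lemma ABC {x : ℂ} (hx : ‖x‖ < 1) :
    Phi x (x ^ 2) * Phi (-x) (x ^ 2) * Phi (x ^ 2) (x ^ 2) = 1 := by
  have hQ := normsq hx
  have hE : Phi (-x ^ 2) (x ^ 2) ≠ 0 := Phi_ne_zero _ hQ (by rwa [norm_neg])
  have h1 := Phi_neg x hQ
  have h2 := Phi_split (-x ^ 2) hQ
  rw [show -x ^ 2 * x ^ 2 = -(x ^ 2) ^ 2 by ring, E_sq hx, ← h1] at h2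
  apply mul_right_cancel₀ hE
  linear_combination -h2

lemma Delta_eq {τ : ℂ} (w : ℂ) (hw : Complex.exp (2 * Real.pi * Complex.I * τ) = w)
    (h1 : ‖w‖ < 1) : Δ τ = w * Phi (-w) w ^ 24 := by
  unfold Δ Phi
  rw [hw, ← (mult_Phi (-w) h1).tprod_pow]
  have e : ∀ n : ℕ, 1 - w ^ (n + 1) = 1 + -w * w ^ n := fun n => by
    rw [pow_succ' w n, neg_mul, sub_eq_add_neg]
  simp only [e]

/-- For every `τ` in the upper half-plane,
`(1/2)·(f(τ/2) − f(τ)/f(τ/2)) = 24·f(τ) + 2¹¹·f(τ)²` where `f(τ) = Δ(2τ)/Δ(τ)`. -/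
theorem half_f_identity (τ : ℂ) (hτ : 0 < τ.im) :
    (1 / 2 : ℂ) * (f (τ / 2) - f τ / f (τ / 2)) = 24 * f τ + 2 ^ 11 * f τ ^ 2 := by
  set x : ℂ := Complex.exp (Real.pi * Complex.I * τ) with hxdef
  have hx0 : x ≠ 0 := Complex.exp_ne_zero _
  have hx : ‖x‖ < 1 := by
    rw [hxdef, Complex.norm_exp]
    have : (Real.pi * Complex.I * τ : ℂ).re = -(Real.pi * τ.im) := by simp
    rw [this, Real.exp_lt_one_iff]
    linarith [mul_pos Real.pi_pos hτ]
  have hQ := normsq hx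
  have d1 : Δ (τ / 2) = x * Phi (-x) x ^ 24 := Delta_eq _ (by rw [hxdef]; congr 1; ring) hx
  have d2 : Δ τ = x ^ 2 * Phi (-x ^ 2) (x ^ 2) ^ 24 :=
    Delta_eq _ (by rw [hxdef, ← Complex.exp_nat_mul]; congr 1; push_cast; ring) hQ
  have d3 : Δ (2 * τ) = (x ^ 2) ^ 2 * Phi (-(x ^ 2) ^ 2) ((x ^ 2) ^ 2) ^ 24 :=
    Delta_eq _ (by rw [hxdef, ← pow_mul, ← Complex.exp_nat_mul]; congr 1; push_cast; ring)
      (normsq hQ)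
  have hs := Phi_split (-x) hx
  rw [show -x * x = -x ^ 2 by ring] at hs
  have hE : Phi (-x ^ 2) (x ^ 2) ≠ 0 := Phi_ne_zero _ hQ (by rwa [norm_neg])
  have hB : Phi (-x) (x ^ 2) ≠ 0 := Phi_ne_zero _ hQ (by rwa [norm_neg])
  have hj := jacobi hx0 hx
  have habc := ABC hx
  rw [E_sq hx] at d3
  rw [hs] at d1
  have f1 : f (τ / 2) = x / Phi (-x) (x ^ 2) ^ 24 := by
    unfold f
    rw [show 2 * (τ / 2) = τ by ring, d1, d2]
    field_simp
  have f2 : f τ = x ^ 2 * Phi (x ^ 2) (x ^ 2) ^ 24 := by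
    unfold f
    rw [d3, d2]
    field_simp
  rw [f1, f2]
  clear f1 f2 d1 d2 d3 hs
  clear_value x
  generalize Phi x (x ^ 2) = A at *
  generalize Phi (-x) (x ^ 2) = B at *
  generalize Phi (x ^ 2) (x ^ 2) = C at *
  have hBi : x / B ^ 24 = x * (A * C) ^ 24 := by
    rw [div_eq_iff (pow_ne_zero _ hB)]
    calc x = x * (A * B * C) ^ 24 := by rw [habc]; ring
      _ = _ := by ring
  have hr : x ^ 2 * C ^ 24 / (x / B ^ 24) = x * C ^ 24 * B ^ 24 := by
    field_simp
  rw [hr, hBi]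
  have h8 : A ^ 8 * B ^ 8 * C ^ 8 = 1 := by
    rw [← mul_pow, ← mul_pow, habc, one_pow]
  have hA : A ^ 24 - B ^ 24 = 48 * x + 4096 * x ^ 3 * C ^ 24 := by
    calc A ^ 24 - B ^ 24 = (A ^ 8 - B ^ 8) ^ 3 + 3 * A ^ 8 * B ^ 8 * (A ^ 8 - B ^ 8) := by ring
      _ = 48 * x * (A ^ 8 * B ^ 8 * C ^ 8) + 4096 * x ^ 3 * C ^ 24 := by rw [hj]; ring
      _ = _ := by rw [h8]; ring
  linear_combination (1 / 2 * x * C ^ 24) * hA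
end

section
/- The function f(τ) = Δ(2τ)/Δ(τ) is invariant under the Hecke congruence group Γ₀(2): for every matrix [[a,b],[c,d]] in SL₂(ℤ) with c even and every τ in the complex upper half-plane ℍ, one has Δ(2·(aτ+b)/(cτ+d)) / Δ((aτ+b)/(cτ+d)) = Δ(2τ)/Δ(τ). -/
open Complex

theorem Delta_eq_discriminant (z : UpperHalfPlane) : Δ (z : ℂ) = ModularForm.discriminant z := by
  rw [ModularForm.discriminant_eq_q_prod]
  simp [Δ, ModularForm.eta_q, Function.Periodic.qParam]

theorem Delta_transform (a b c d : ℤ) (hdet : a * d - b * c = 1) (τ : ℂ) (hτ : 0 < τ.im) :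
    Δ (((a : ℂ) * τ + (b : ℂ)) / ((c : ℂ) * τ + (d : ℂ))) =
      ((c : ℂ) * τ + (d : ℂ)) ^ 12 * Δ τ := by
  let γ : Matrix.SpecialLinearGroup (Fin 2) ℤ :=
    ⟨!![a, b; c, d], by rw [Matrix.det_fin_two_of]; exact hdet⟩
  let z : UpperHalfPlane := ⟨τ, hτ⟩
  have h := congrFun (SlashInvariantForm.slash_action_generators_SL2Z ModularForm.discriminant_S_invariant
    ModularForm.discriminant_T_invariant γ) z
  rw [ModularForm.SL_slash_apply, ← Delta_eq_discriminant, ← Delta_eq_discriminant,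
    UpperHalfPlane.specialLinearGroup_apply] at h
  have hne := UpperHalfPlane.denom_ne_zero (γ : Matrix.GeneralLinearGroup (Fin 2) ℝ) z
  have hd : UpperHalfPlane.denom (γ : Matrix.GeneralLinearGroup (Fin 2) ℝ) z
      = (c : ℂ) * τ + (d : ℂ) := by
    have h3 := ModularGroup.denom_apply γ z
    exact h3.trans (by simp [γ, z])
  rw [hd] at h hne
  have h2 : Δ (((a : ℂ) * τ + (b : ℂ)) / ((c : ℂ) * τ + (d : ℂ))) *
      ((c : ℂ) * τ + (d : ℂ)) ^ (-12 : ℤ) = Δ τ := by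
    simpa [γ, z] using h
  rw [← h2, mul_left_comm, zpow_neg, show (12 : ℤ) = ((12 : ℕ) : ℤ) from rfl, zpow_natCast,
    mul_inv_cancel₀ (pow_ne_zero 12 hne), mul_one]

/-- The function `f(τ) = Δ(2τ)/Δ(τ)` is invariant under the Hecke congruence group
`Γ₀(2)`: for every integer matrix `[[a,b],[c,d]]` with `ad − bc = 1` and `c` even, and
every `τ` in the upper half-plane, `Δ(2·γτ)/Δ(γτ) = Δ(2τ)/Δ(τ)` where
`γτ = (aτ+b)/(cτ+d)`. -/
theorem delta_ratio_Gamma0_two_invariant (a b c d : ℤ) (hdet : a * d - b * c = 1)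
    (hc : 2 ∣ c) (τ : ℂ) (hτ : 0 < τ.im) :
    Δ (2 * (((a : ℂ) * τ + (b : ℂ)) / ((c : ℂ) * τ + (d : ℂ)))) /
        Δ (((a : ℂ) * τ + (b : ℂ)) / ((c : ℂ) * τ + (d : ℂ)))
      = Δ (2 * τ) / Δ τ := by
  obtain ⟨e, rfl⟩ := hc
  have h1 := Delta_transform a b (2 * e) d hdet τ hτ
  have hτ2 : 0 < (2 * τ).im := by simpa using hτ
  have h2 := Delta_transform a (2 * b) e d (by linarith) (2 * τ) hτ2
  have key : 2 * (((a : ℂ) * τ + (b : ℂ)) / (((2 * e : ℤ) : ℂ) * τ + (d : ℂ))) =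
      ((a : ℂ) * (2 * τ) + ((2 * b : ℤ) : ℂ)) / ((e : ℂ) * (2 * τ) + (d : ℂ)) := by
    push_cast
    rw [← mul_div_assoc]
    congr 1 <;> ring
  have hne : (((2 * e : ℤ) : ℂ) * τ + (d : ℂ)) ≠ 0 := by
    intro h0
    have him := congrArg Complex.im h0
    have hre := congrArg Complex.re h0
    have he : e = 0 := by
      simpa [hτ.ne'] using him
    subst he
    have hd : d = 0 := by simpa using hre
    subst hd
    simp at hdet
  have hee : (e : ℂ) * (2 * τ) + (d : ℂ) = (((2 * e : ℤ) : ℂ) * τ + (d : ℂ)) := by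
    push_cast; ring
  rw [key, h2, h1, hee]
  exact mul_div_mul_left _ _ (pow_ne_zero 12 hne)
end

section
/- Let F : ℍ → ℂ be any function invariant under Γ₀(2), i.e. F((aτ+b)/(cτ+d)) = F(τ) for every matrix [[a,b],[c,d]] in SL₂(ℤ) with c even and every τ ∈ ℍ. Then the function G(τ) := F(τ/2) + F((τ+1)/2) is also invariant under Γ₀(2): G((aτ+b)/(cτ+d)) = G(τ) for every such matrix and every τ ∈ ℍ. -/
theorem hecke_aux (F : ℂ → ℂ)
    (hF : ∀ a b c d : ℤ, a * d - b * c = 1 → 2 ∣ c → ∀ τ : ℂ, 0 < τ.im →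
      F (((a : ℂ) * τ + (b : ℂ)) / ((c : ℂ) * τ + (d : ℂ))) = F τ)
    (a b c d : ℤ) (hdet : a * d - b * c = 1) (τ : ℂ) (hτ : 0 < τ.im)
    (i j k : ℤ) (hk : b + i * d - j * (a + i * c) = 2 * k) :
    F (((((a : ℂ) * τ + (b : ℂ)) / ((c : ℂ) * τ + (d : ℂ))) + i) / 2) = F ((τ + j) / 2) := by
  have hy : (c : ℂ) * τ + (d : ℂ) ≠ 0 := by
    intro h
    have him := congrArg Complex.im h
    have hre := congrArg Complex.re h
    simp at him hre
    rcases him with h0 | h0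
    · subst h0
      simp at hre
      subst hre
      simp at hdet
    · exact hτ.ne' h0
  have him : 0 < ((τ + j) / 2).im := by
    have : ((τ + j) / 2).im = τ.im / 2 := by
      rw [show (τ + j) / 2 = (τ + j) / ((2 : ℝ) : ℂ) by norm_num, Complex.div_ofReal_im]
      simp
    rw [this]
    linarith
  have hkC : (b : ℂ) + i * d - j * (a + i * c) = 2 * k := by exact_mod_cast hk
  rw [← hF (a + i * c) k (2 * c) (d - c * j) (by linear_combination hdet + c * hk)
    ⟨c, rfl⟩ _ him]
  congr 1
  have hden : ((2 * c : ℤ) : ℂ) * ((τ + j) / 2) + ((d - c * j : ℤ) : ℂ) = c * τ + d := by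
    push_cast
    ring
  rw [hden]
  push_cast
  rw [div_add' _ _ _ hy, div_div, div_eq_div_iff (mul_ne_zero hy two_ne_zero) hy]
  linear_combination ((c : ℂ) * τ + d) * hkC

/-- If `F : ℍ → ℂ` is invariant under `Γ₀(2)`, then so is
`G(τ) := F(τ/2) + F((τ+1)/2)`.  Here functions on the upper half-plane are modelled as
functions on `ℂ`, with all hypotheses and conclusions restricted to `τ` with `0 < Im τ`. -/
theorem hecke_image_Gamma0_two_invariant (F : ℂ → ℂ)
    (hF : ∀ a b c d : ℤ, a * d - b * c = 1 → 2 ∣ c → ∀ τ : ℂ, 0 < τ.im →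
      F (((a : ℂ) * τ + (b : ℂ)) / ((c : ℂ) * τ + (d : ℂ))) = F τ)
    (a b c d : ℤ) (hdet : a * d - b * c = 1) (hc : 2 ∣ c) (τ : ℂ) (hτ : 0 < τ.im) :
    F ((((a : ℂ) * τ + (b : ℂ)) / ((c : ℂ) * τ + (d : ℂ))) / 2) +
        F (((((a : ℂ) * τ + (b : ℂ)) / ((c : ℂ) * τ + (d : ℂ))) + 1) / 2)
      = F (τ / 2) + F ((τ + 1) / 2) := by
  obtain ⟨e, rfl⟩ := hc
  have hodd : Odd (a * d) := ⟨b * e, by linear_combination hdet⟩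
  obtain ⟨⟨m, hm⟩, ⟨n, hn⟩⟩ := Int.odd_mul.mp hodd
  have key := hecke_aux F hF a b (2 * e) d hdet τ hτ
  rcases Int.even_or_odd' b with ⟨l, hl | hl⟩
  · have h0 := key 0 0 l (by rw [hl]; ring)
    have h1 := key 1 1 (l + n - m - e) (by rw [hl, hm, hn]; ring)
    simp only [Int.cast_zero, Int.cast_one, add_zero] at h0 h1
    rw [h0, h1]
  · have h0 := key 0 1 (l - m) (by rw [hl, hm]; ring)
    have h1 := key 1 0 (l + n + 1) (by rw [hl, hn]; ring)
    simp only [Int.cast_zero, Int.cast_one, add_zero] at h0 h1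
    rw [h0, h1, add_comm]
end

section
/- Let φ : S → H be a group homomorphism whose kernel has exactly two elements and is contained in the center of S. Let G₁ and G₂ be subgroups of S such that the restriction of φ to G₁ is injective, the restriction of φ to G₂ is injective, and φ(G₁) = φ(G₂). If the common image G := φ(G₁) is a perfect group (i.e. G equals its own commutator subgroup), then G₁ = G₂. -/
open scoped commutatorElement in
theorem le_of_perfect_aux {S H : Type*} [Group S] [Group H] (φ : S →* H)
    (hcent : φ.ker ≤ Subgroup.center S) (G₁ G₂ : Subgroup S)
    (hinj₁ : Set.InjOn φ (G₁ : Set S)) (himg : G₁.map φ = G₂.map φ)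
    (hperf : ⁅G₁.map φ, G₁.map φ⁆ = G₁.map φ) : G₁ ≤ G₂ := by
  have hlift : ∀ a ∈ G₁, ∃ c ∈ G₂, ∃ z ∈ Subgroup.center S, a = c * z := by
    intro a ha
    have h : φ a ∈ G₂.map φ := himg ▸ Subgroup.mem_map_of_mem φ ha
    obtain ⟨c, hc, hca⟩ := h
    refine ⟨c, hc, c⁻¹ * a, hcent ?_, by group⟩
    simp [MonoidHom.mem_ker, hca]
  have hcomm : ⁅G₁, G₁⁆ ≤ G₂ := by
    rw [Subgroup.commutator_le]
    intro a ha b hb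
    obtain ⟨c, hc, z, hz, rfl⟩ := hlift a ha
    obtain ⟨d, hd, w, hw, rfl⟩ := hlift b hb
    have hz' := Subgroup.mem_center_iff.1 hz
    have hw' := Subgroup.mem_center_iff.1 hw
    have e : ⁅c * z, d * w⁆ = ⁅c, d⁆ := by
      have h1 : c * z * (d * w) = c * d * (z * w) := by
        rw [mul_assoc c z, ← mul_assoc z d, ← hz' d]; group
      have h2 : d * w * (c * z) = d * c * (z * w) := by
        rw [mul_assoc d w, ← mul_assoc w c, ← hw' c, hw' z]; group
      have h3 : ∀ x y : S, ⁅x, y⁆ = (x * y) * (y * x)⁻¹ := by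
        intro x y; simp [commutatorElement_def, mul_assoc]
      rw [h3, h3, h1, h2]; group
    rw [e]
    exact G₂.commutator_le_self (Subgroup.commutator_mem_commutator hc hd)
  intro x hx
  have h : φ x ∈ (⁅G₁, G₁⁆).map φ := by
    rw [Subgroup.map_commutator, hperf]
    exact Subgroup.mem_map_of_mem φ hx
  obtain ⟨y, hy, hyx⟩ := h
  have : y = x := hinj₁ (G₁.commutator_le_self hy) hx hyx
  exact this ▸ hcomm hy

/-- Uniqueness of lifts of a perfect group through a central extension with kernel of
order two: if `φ : S → H` has kernel of exactly two elements contained in the center of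
`S`, and `G₁`, `G₂` are subgroups of `S` on which `φ` is injective with
`φ(G₁) = φ(G₂) =: G` a perfect group, then `G₁ = G₂`. -/
theorem unique_lift_of_perfect {S H : Type*} [Group S] [Group H] (φ : S →* H)
    (hker : Nat.card φ.ker = 2) (hcent : φ.ker ≤ Subgroup.center S)
    (G₁ G₂ : Subgroup S)
    (hinj₁ : Set.InjOn φ (G₁ : Set S)) (hinj₂ : Set.InjOn φ (G₂ : Set S))
    (himg : G₁.map φ = G₂.map φ)
    (hperf : ⁅G₁.map φ, G₁.map φ⁆ = G₁.map φ) :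
    G₁ = G₂ := by
  exact le_antisymm (le_of_perfect_aux φ hcent G₁ G₂ hinj₁ himg hperf)
    (le_of_perfect_aux φ hcent G₂ G₁ hinj₂ himg.symm (himg ▸ hperf))
end
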